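/- arXiv:2212.06533 — 3 statements merged into one kernel-verified Lean document; each statement's English description precedes it below -/
import Mathlib

section
/- Let n ∈ ℕ and α > 1/2. Suppose f : ℝ → ℂ is (n+1) times continuously differentiable and there exist M, R > 0 such that |f^{(k)}(x)| ≤ M·|x|^{−k−α} for all |x| ≥ R and all k = 0,…,n+1. Then f belongs to the class 𝔚_n; that is: (i) for every k = 0,…,n there exists an integrable w_k : ℝ → ℂ with f^{(k)}(x)·(x−i)^k = ∫_ℝ w_k(t)·e^{ixt} dt for all x ∈ ℝ, and (ii) for every k = 1,…,n the function x ↦ f^{(k)}(x)·(1+|x|)^{k−1} is integrable on ℝ. -/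
open MeasureTheory

section helpers

open FourierTransform TemperedDistribution ENNReal Filter
open scoped SchwartzMap LineDeriv Laplacian Real ContDiff

/-- A continuous function with decay `(1+|x|)^{-β}` at infinity, `β > 1`, is integrable. -/
lemma aux_integrable {E : Type*} [NormedAddCommGroup E] (u : ℝ → E) (hu : Continuous u)
    (C R β : ℝ) (hβ : 1 < β)
    (h : ∀ x : ℝ, R ≤ |x| → ‖u x‖ ≤ C * (1 + |x|) ^ (-β)) : Integrable u := by
  have hg : Integrable (fun x : ℝ => (1 + ‖x‖) ^ (-β)) :=
    integrable_one_add_norm (by simpa using hβ)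
  refine hu.locallyIntegrable.integrable_of_isBigO_cocompact (g := fun x : ℝ => (1 + ‖x‖) ^ (-β))
    ?_ (hg.integrableAtFilter _)
  refine Asymptotics.IsBigO.of_bound C ?_
  have : ∀ᶠ x : ℝ in cocompact ℝ, R ≤ ‖x‖ :=
    tendsto_norm_cocompact_atTop.eventually (eventually_ge_atTop R)
  filter_upwards [this] with x hx
  rw [Real.norm_of_nonneg (by positivity : (0 : ℝ) ≤ (1 + ‖x‖) ^ (-β))]
  exact h x hx

/-- A continuous function with decay `(1+|x|)^{-β}` at infinity, `β > 1/2`, is in `L²`. -/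
lemma aux_memLp (u : ℝ → ℂ) (hu : Continuous u)
    (C R β : ℝ) (hβ : 1 / 2 < β)
    (h : ∀ x : ℝ, R ≤ |x| → ‖u x‖ ≤ C * (1 + |x|) ^ (-β)) : MemLp u 2 := by
  rw [memLp_two_iff_integrable_sq_norm hu.aestronglyMeasurable]
  refine aux_integrable _ (by fun_prop) (C ^ 2) R (2 * β) (by linarith) fun x hx => ?_
  have h1 := h x hx
  rw [Real.norm_of_nonneg (by positivity)]
  calc ‖u x‖ ^ 2 ≤ (C * (1 + |x|) ^ (-β)) ^ 2 := by gcongr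
    _ = C ^ 2 * (1 + |x|) ^ (-(2 * β)) := by
      rw [mul_pow, ← Real.rpow_mul_natCast (by positivity)]
      congr 2
      push_cast
      ring

/-- The one-dimensional Sobolev lemma: `h, h' ∈ L²` implies that `h` has an integrable
Fourier transform. -/
lemma aux_key (h h' : ℝ → ℂ) (hd : ∀ x, HasDerivAt h (h' x) x)
    (h2 : MemLp h 2) (h2' : MemLp h' 2) :
    ∃ v : ℝ → ℂ, Integrable v ∧ ∀ x : ℝ, h x = 𝓕⁻ v x := by
  have hc : Continuous h := continuous_iff_continuousAt.2 fun x => (hd x).continuousAt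
  set H : 𝓢'(ℝ, ℂ) := ((h2.toLp h : Lp ℂ 2 (volume : Measure ℝ)) : 𝓢'(ℝ, ℂ)) with hH
  set H' : 𝓢'(ℝ, ℂ) := ((h2'.toLp h' : Lp ℂ 2 (volume : Measure ℝ)) : 𝓢'(ℝ, ℂ)) with hH'
  have H_apply : ∀ g : 𝓢(ℝ, ℂ), H g = ∫ x, g x • h x := by
    intro g
    rw [hH, Lp.toTemperedDistribution_apply]
    refine integral_congr_ae ?_
    filter_upwards [h2.coeFn_toLp] with x hx
    rw [hx]
  have H'_apply : ∀ g : 𝓢(ℝ, ℂ), H' g = ∫ x, g x • h' x := by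
    intro g
    rw [hH', Lp.toTemperedDistribution_apply]
    refine integral_congr_ae ?_
    filter_upwards [h2'.coeFn_toLp] with x hx
    rw [hx]
  have hder : ∂_{(1 : ℝ)} H = H' := by
    ext g
    rw [lineDerivOp_apply_apply, H_apply, H'_apply]
    set g' : 𝓢(ℝ, ℂ) := ∂_{(1 : ℝ)} g with hg'
    have hdg : ∀ x, HasDerivAt g (g' x) x := by
      intro x
      rw [hg', SchwartzMap.lineDerivOp_apply_eq_fderiv]
      exact (g.differentiableAt (x := x)).hasDerivAt
    have := integral_mul_deriv_eq_deriv_mul_of_integrable (u := g) (v := h)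
      (u' := g') (v' := h') (fun x _ => hdg x) (fun x _ => hd x)
      ((g.memLp 2).integrable_mul h2') ((g'.memLp 2).integrable_mul h2)
      ((g.memLp 2).integrable_mul h2)
    simp only [smul_eq_mul]
    rw [this, ← integral_neg]
    simp
  have hS0 : MemSobolev 0 2 H := memSobolev_zero_iff.2 ⟨_, rfl⟩
  have hS0' : MemSobolev 0 2 H' := memSobolev_zero_iff.2 ⟨_, rfl⟩
  have hSm : MemSobolev (-1) 2 (besselPotential ℝ ℂ 2 H) := by
    have e : besselPotential ℝ ℂ 2 H =
        H + (-(1 / ((2 * π) ^ 2 : ℂ))) • (∂_{(1 : ℝ)} H') := by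
      have hg1 : (fun x : ℝ => ((inner ℝ x (1 : ℝ) : ℝ) : ℂ)).HasTemperateGrowth := by fun_prop
      have hsym : (fun x : ℝ => (((1 + ‖x‖ ^ 2) ^ ((2 : ℝ) / 2) : ℝ) : ℂ)) =
          (fun _ => (1 : ℂ)) + (fun x : ℝ => ((inner ℝ x (1 : ℝ) : ℝ) : ℂ)) *
            (fun x : ℝ => ((inner ℝ x (1 : ℝ) : ℝ) : ℂ)) := by
        ext x
        simp [pow_two]
      rw [← hder, lineDeriv_eq_fourierMultiplierCLM, lineDeriv_eq_fourierMultiplierCLM,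
        map_smul, fourierMultiplierCLM_fourierMultiplierCLM_apply hg1 hg1, besselPotential,
        hsym, fourierMultiplierCLM_apply, smulLeftCLM_add (by fun_prop) (hg1.mul hg1), smul_smul,
        smul_smul, fourierMultiplierCLM_apply]
      have hc : (-(1 / ((2 * π) ^ 2 : ℂ)) * (2 * π * Complex.I) * (2 * π * Complex.I)) = 1 := by
        have : (π : ℂ) ≠ 0 := by exact_mod_cast Real.pi_ne_zero
        field_simp
        simp
      rw [hc, one_smul, add_apply, FourierTransform.fourierInv_add, smulLeftCLM_const, one_smul,
        fourierInv_fourier_eq]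
    rw [e]
    refine (hS0.mono (by norm_num)).add (MemSobolev.smul _ ?_)
    simpa using hS0'.lineDerivOp (m := (1 : ℝ))
  have hS1 : MemSobolev 1 2 H := by
    rw [memSobolev_besselPotential_iff] at hSm
    norm_num at hSm
    exact hSm
  obtain ⟨v, hv⟩ := hS1.fourier_memL1 (by simp)
  have hvi : Integrable (v : ℝ → ℂ) := L1.integrable_coeFn v
  refine ⟨v, hvi, ?_⟩
  have hcv : Continuous (𝓕⁻ (v : ℝ → ℂ)) := by
    rw [← Real.Lp.coe_fourierTransformInv]
    exact map_continuous _
  have hae : ∀ᵐ x ∂(volume : Measure ℝ), h x = 𝓕⁻ (v : ℝ → ℂ) x := by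
    refine ae_eq_of_integral_contDiff_smul_eq hc.locallyIntegrable hcv.locallyIntegrable ?_
    intro g g_smooth g_cpt
    have hg₁ : HasCompactSupport (Complex.ofRealCLM ∘ g) := g_cpt.comp_left rfl
    have hg₂ : ContDiff ℝ ∞ (Complex.ofRealCLM ∘ g) := by fun_prop
    set G : 𝓢(ℝ, ℂ) := hg₁.toSchwartzMap hg₂ with hG
    have hGa : ∀ x, G x = (g x : ℂ) := fun x => rfl
    have e1 : H G = ∫ x, 𝓕⁻ G x • v x := by
      rw [← Lp.toTemperedDistribution_apply, ← hv, TemperedDistribution.fourier_apply, fourier_fourierInv_eq]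
    have e2 : ∫ x, 𝓕⁻ G x • v x = ∫ x, G x • 𝓕⁻ (v : ℝ → ℂ) x := by
      rw [SchwartzMap.fourierInv_coe]
      have := VectorFourier.integral_fourierIntegral_smul_eq_flip (L := -innerₗ ℝ)
        (μ := volume) (ν := volume)
        Real.continuous_fourierChar (by simp only [LinearMap.neg_apply, innerₗ_apply_apply]; fun_prop)
        G.integrable hvi
      have hfl : (-innerₗ ℝ).flip = -innerₗ ℝ := by
        ext; simp
      rw [hfl] at this
      exact this
    have e3 := (H_apply G).symm.trans (e1.trans e2)
    simp only [hGa] at e3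
    simpa using e3
  exact fun x => congrFun (hc.ae_eq_iff_eq _ hcv |>.1 hae) x

lemma aux_witness (h h' : ℝ → ℂ) (hd : ∀ x, HasDerivAt h (h' x) x)
    (h2 : MemLp h 2) (h2' : MemLp h' 2) :
    ∃ w : ℝ → ℂ, Integrable w ∧ ∀ x : ℝ,
      h x = ∫ t : ℝ, w t * Complex.exp (Complex.I * x * t) := by
  obtain ⟨v, hv, hx⟩ := aux_key h h' hd h2 h2'
  have hpi : (2 * π)⁻¹ ≠ 0 := by positivity
  refine ⟨fun t => ((2 * π)⁻¹ : ℝ) • v ((2 * π)⁻¹ * t), ?_, fun x => ?_⟩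
  · exact (hv.comp_mul_left' hpi).smul ((2 * π)⁻¹ : ℝ)
  · rw [hx x, Real.fourierInv_eq']
    have := Measure.integral_comp_mul_left
      (fun ξ : ℝ => Complex.exp ((↑(2 * π * inner ℝ ξ x) * Complex.I)) • v ξ) ((2 * π)⁻¹)
    rw [inv_inv, abs_of_pos (by positivity), eq_comm, ← eq_inv_smul_iff₀ (by positivity)] at this
    rw [this, ← integral_smul]
    refine integral_congr_ae (ae_of_all _ fun t => ?_)
    simp only [smul_eq_mul, Complex.real_smul, RCLike.inner_apply, conj_trivial]
    have : Complex.exp (↑(2 * π * (x * ((2 * π)⁻¹ * t))) * Complex.I)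
        = Complex.exp (Complex.I * x * t) := by
      congr 1
      have : (2 * π * (x * ((2 * π)⁻¹ * t))) = x * t := by field_simp
      rw [this]
      push_cast
      ring
    rw [this]
    ring

end helpers

/-- Let `n ∈ ℕ`, `α > 1/2`, and let `f : ℝ → ℂ` be `(n+1)` times continuously differentiable
with `|f⁽ᵏ⁾(x)| ≤ M·|x|^{−k−α}` for `|x| ≥ R` and `k = 0,…,n+1` (some `M, R > 0`).
Then `f ∈ 𝔚_n`:
(i) for `k = 0,…,n` there is an integrable `w_k` with
    `f⁽ᵏ⁾(x)·(x−i)ᵏ = ∫ w_k(t)·e^{ixt} dt` for all `x`, and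
(ii) for `k = 1,…,n` the function `x ↦ f⁽ᵏ⁾(x)·(1+|x|)^{k−1}` is integrable. -/
theorem stmt3 (n : ℕ) (α : ℝ) (hα : 1 / 2 < α) (f : ℝ → ℂ)
    (hf : ContDiff ℝ (n + 1) f) (M R : ℝ) (hM : 0 < M) (hR : 0 < R)
    (hdecay : ∀ k ≤ n + 1, ∀ x : ℝ, R ≤ |x| →
      ‖iteratedDeriv k f x‖ ≤ M * |x| ^ (-(k : ℝ) - α)) :
    (∀ k ≤ n, ∃ w : ℝ → ℂ, Integrable w ∧ ∀ x : ℝ,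
        iteratedDeriv k f x * ((x : ℂ) - Complex.I) ^ k =
          ∫ t : ℝ, w t * Complex.exp (Complex.I * x * t)) ∧
    (∀ k, 1 ≤ k → k ≤ n →
      Integrable fun x : ℝ => iteratedDeriv k f x * ((1 + |x| : ℝ) : ℂ) ^ (k - 1)) := by
  have hc1 : 0 < 1 + 1 / R := by positivity
  have hdec : ∀ j ≤ n + 1, ∃ C : ℝ, 0 ≤ C ∧ ∀ x : ℝ, R ≤ |x| →
      ‖iteratedDeriv j f x‖ ≤ C * (1 + |x|) ^ (-((j : ℝ) + α)) := by
    intro j hj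
    refine ⟨M * (1 + 1 / R) ^ ((j : ℝ) + α), by positivity, fun x hx => ?_⟩
    refine (hdecay j hj x hx).trans ?_
    have hx0 : 0 < |x| := hR.trans_le hx
    have h1 : (1 + |x|) / (1 + 1 / R) ≤ |x| := by
      rw [div_le_iff₀ hc1]
      have : 1 ≤ |x| * (1 / R) := by
        rw [mul_one_div, le_div_iff₀ hR]; linarith
      linarith
    have h2 : |x| ^ (-((j : ℝ) + α)) ≤ ((1 + |x|) / (1 + 1 / R)) ^ (-((j : ℝ) + α)) :=
      Real.rpow_le_rpow_of_nonpos (by positivity) h1 (by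
        have : (0 : ℝ) ≤ j := by positivity
        linarith)
    rw [Real.div_rpow (by positivity) hc1.le, Real.rpow_neg hc1.le, div_inv_eq_mul] at h2
    rw [show -(j : ℝ) - α = -((j : ℝ) + α) by ring, mul_assoc]
    gcongr
    linarith
  have hcont : ∀ j ≤ n + 1, Continuous (iteratedDeriv j f) := by
    intro j hj
    exact hf.continuous_iteratedDeriv j (by exact_mod_cast hj)
  -- decay of products
  have hprod : ∀ j ≤ n + 1, ∀ m : ℕ, ∀ p : ℝ → ℂ, (∀ x, ‖p x‖ ≤ (1 + |x|) ^ m) →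
      ∃ C : ℝ, ∀ x : ℝ, R ≤ |x| →
        ‖iteratedDeriv j f x * p x‖ ≤ C * (1 + |x|) ^ (-((j : ℝ) - m + α)) := by
    intro j hj m p hp
    obtain ⟨C, hC, h⟩ := hdec j hj
    refine ⟨C, fun x hx => ?_⟩
    rw [norm_mul]
    calc _ ≤ (C * (1 + |x|) ^ (-((j : ℝ) + α))) * (1 + |x|) ^ m :=
          mul_le_mul (h x hx) (hp x) (norm_nonneg _) (by positivity)
      _ = _ := by
          rw [mul_assoc, ← Real.rpow_natCast, ← Real.rpow_add (by positivity)]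
          congr 2
          ring
  have hpow : ∀ m : ℕ, ∀ x : ℝ, ‖((x : ℂ) - Complex.I) ^ m‖ ≤ (1 + |x|) ^ m := by
    intro m x
    rw [norm_pow]
    gcongr
    refine (norm_sub_le _ _).trans ?_
    simp [add_comm]
  refine ⟨fun k hk => ?_, fun k hk1 hk => ?_⟩
  · have hd1 : ∀ x : ℝ, HasDerivAt (iteratedDeriv k f) (iteratedDeriv (k + 1) f x) x := by
      intro x
      rw [iteratedDeriv_succ]
      exact ((hf.differentiable_iteratedDeriv k (by exact_mod_cast Nat.lt_succ_of_le hk)) x).hasDerivAt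
    have hd2 : ∀ x : ℝ, HasDerivAt (fun x : ℝ => ((x : ℂ) - Complex.I) ^ k)
        ((k : ℂ) * ((x : ℂ) - Complex.I) ^ (k - 1)) x := by
      intro x
      simpa using ((Complex.ofRealCLM.hasDerivAt (x := x)).sub_const Complex.I).fun_pow k
    refine aux_witness (fun x => iteratedDeriv k f x * ((x : ℂ) - Complex.I) ^ k)
      (fun x => iteratedDeriv (k + 1) f x * ((x : ℂ) - Complex.I) ^ k +
        iteratedDeriv k f x * ((k : ℂ) * ((x : ℂ) - Complex.I) ^ (k - 1)))
      (fun x => (hd1 x).mul (hd2 x)) ?_ ?_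
    · obtain ⟨C, hC⟩ := hprod k (by omega) k _ (hpow k)
      have := hcont k (by omega)
      exact aux_memLp _ (by fun_prop) C R _ (by simpa using hα) hC
    · refine MemLp.add ?_ ?_
      · obtain ⟨C, hC⟩ := hprod (k + 1) (by omega) k _ (hpow k)
        have := hcont (k + 1) (by omega)
        exact aux_memLp _ (by fun_prop) C R _ (by push_cast; linarith) hC
      · obtain ⟨C, hC⟩ := hprod k (by omega) (k - 1) _ (hpow (k - 1))
        have := hcont k (by omega)
        have h3 : MemLp (fun x : ℝ => iteratedDeriv k f x * ((x : ℂ) - Complex.I) ^ (k - 1)) 2 :=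
          aux_memLp _ (by fun_prop) C R _ (by
            have : ((k - 1 : ℕ) : ℝ) ≤ k := by exact_mod_cast Nat.sub_le k 1
            linarith) hC
        convert h3.const_mul (k : ℂ) using 2
        ring
  · obtain ⟨C, hC⟩ := hprod k (by omega) (k - 1)
      (fun x => ((1 + |x| : ℝ) : ℂ) ^ (k - 1)) (fun x => by
        rw [norm_pow, Complex.norm_real, Real.norm_of_nonneg (by positivity)])
    have := hcont k (by omega)
    refine aux_integrable _ (by fun_prop) C R _ ?_ hC
    rw [Nat.cast_sub hk1]
    push_cast
    linarith
end

section
/- Let n ≥ 1 and let f ∈ 𝔅_n, i.e. f : ℝ → ℂ is n times continuously differentiable, for each p = 0,…,n the function x ↦ f^{(p)}(x)·(x−i)^p tends to 0 at ±∞, and there is an integrable w : ℝ → ℂ with f^{(n)}(x) = ∫_ℝ w(t)e^{ixt} dt for all x. Then for every ε > 0 there exists g ∈ 𝔟_n — i.e. g : ℝ → ℂ is n times continuously differentiable, for each p = 0,…,n the function x ↦ g^{(p)}(x)·(x−i)^p tends to 0 at ±∞ and equals x ↦ ∫_ℝ v_p(t)e^{ixt} dt for some integrable v_p, and g^{(n)}(x)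 = ∫_ℝ v(t)e^{ixt} dt for some integrable v — such that Σ_{p=0}^n sup_{x∈ℝ} |(f^{(p)}(x) − g^{(p)}(x))·(x−i)^p| + ∫_ℝ |w(t) − v(t)| dt < ε. In other words, 𝔟_n is dense in 𝔅_n with respect to the norm ‖f‖ = Σ_{p=0}^n ‖f^{(p)}u^p‖_∞ + ‖\widehat{f^{(n)}}‖₁. -/
open MeasureTheory Filter
open scoped FourierTransform SchwartzMap Convolution

lemma aux_planch (φ : ℝ → ℂ) (hc : Continuous φ) (hs : HasCompactSupport φ) :
    Integrable (fun t => ‖𝓕 φ t‖ ^ 2) ∧ ∫ t, ‖𝓕 φ t‖ ^ 2 = ∫ x, ‖φ x‖ ^ 2 := by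
  have hi : Integrable φ := hc.integrable_of_hasCompactSupport hs
  have h2 : MemLp φ 2 volume := hc.memLp_of_hasCompactSupport hs
  have hFc : Continuous (𝓕 φ) :=
    VectorFourier.fourierIntegral_continuous Real.continuous_fourierChar continuous_inner hi
  set F : Lp ℂ 2 (volume : Measure ℝ) := 𝓕 (h2.toLp φ) with hF
  have hae : (F : ℝ → ℂ) =ᵐ[volume] 𝓕 φ := by
    apply ae_eq_of_integral_contDiff_smul_eq
    · exact (Lp.memLp F).locallyIntegrable (by norm_num)
    · exact hFc.locallyIntegrable
    intro g hg hgs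
    have hg1 : ContDiff ℝ (⊤ : ℕ∞) (fun x => (g x : ℂ)) := Complex.ofRealCLM.contDiff.comp hg
    have hg2 : HasCompactSupport (fun x => (g x : ℂ)) :=
      hgs.comp_left (g := fun y : ℝ => (y : ℂ)) (by simp)
    set G : 𝓢(ℝ, ℂ) := hg2.toSchwartzMap hg1 with hG
    have h1 := congrArg (fun T => T G) (Lp.fourier_toTemperedDistribution_eq (h2.toLp φ))
    simp only [TemperedDistribution.fourier_apply, Lp.toTemperedDistribution_apply] at h1
    have h3 : ∫ x, (𝓕 G) x • (h2.toLp φ) x = ∫ x, (𝓕 G) x • φ x := by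
      apply integral_congr_ae
      filter_upwards [h2.coeFn_toLp] with x hx
      rw [hx]
    have h4 : ∫ x, (𝓕 G) x • φ x = ∫ x, G x • 𝓕 φ x := by
      simpa [SchwartzMap.fourier_coe] using!
        VectorFourier.integral_fourierIntegral_smul_eq_flip (L := innerₗ ℝ)
        Real.continuous_fourierChar continuous_inner G.integrable hi
    have h5 := h1.symm.trans (h3.trans h4)
    simpa [hG] using h5
  have hm : MemLp (𝓕 φ) 2 volume := (memLp_congr_ae hae).1 (Lp.memLp F)
  refine ⟨(memLp_two_iff_integrable_sq_norm hFc.aestronglyMeasurable).1 hm, ?_⟩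
  have hn : ‖F‖ = ‖h2.toLp φ‖ := Lp.norm_fourier_eq _
  have key : ∀ f : Lp ℂ 2 (volume : Measure ℝ), ‖f‖ ^ 2 = ∫ x, ‖f x‖ ^ 2 := by
    intro f
    have h := inner_self_eq_norm_sq_to_K (𝕜 := ℂ) f
    rw [L2.inner_def] at h
    simp_rw [inner_self_eq_norm_sq_to_K] at h
    have h' : ((∫ x, ‖f x‖ ^ 2 : ℝ) : ℂ) = ((‖f‖ ^ 2 : ℝ) : ℂ) := by
      rw [← integral_complex_ofReal]
      push_cast
      exact h
    exact (Complex.ofReal_injective h').symm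
  have e1 := key F
  have e2 := key (h2.toLp φ)
  rw [hn, e2] at e1
  calc _ = ∫ x, ‖F x‖ ^ 2 := integral_congr_ae (by filter_upwards [hae] with x hx; rw [hx])
    _ = _ := e1.symm
    _ = _ := integral_congr_ae (by filter_upwards [h2.coeFn_toLp] with x hx; rw [hx])

lemma aux_conv (a w : ℝ → ℂ) (ha : Integrable a) (hw : Integrable w) :
    Integrable (a ⋆[ContinuousLinearMap.mul ℝ ℂ] w) ∧ ∀ x : ℝ,
      ∫ t : ℝ, (a ⋆[ContinuousLinearMap.mul ℝ ℂ] w) t * Complex.exp (Complex.I * x * t) =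
      (∫ t : ℝ, a t * Complex.exp (Complex.I * x * t)) *
      (∫ t : ℝ, w t * Complex.exp (Complex.I * x * t)) := by
  refine ⟨ha.integrable_convolution _ hw, fun x => ?_⟩
  have hI : ∀ {a : ℝ → ℂ}, Integrable a →
      Integrable (fun t : ℝ => a t * Complex.exp (Complex.I * x * t)) := by
    intro a ha
    refine ha.mul_bdd (c := 1) (by fun_prop) (ae_of_all _ fun t => ?_)
    rw [Complex.norm_exp]; simp
  have := integral_convolution (ContinuousLinearMap.mul ℝ ℂ) (hI ha) (hI hw)
  simp only [ContinuousLinearMap.mul_apply'] at this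
  rw [← this]
  congr 1
  ext t
  simp only [convolution_def, ContinuousLinearMap.mul_apply']
  rw [← integral_mul_const]
  congr 1
  ext s
  have : Complex.exp (Complex.I * x * t) =
    Complex.exp (Complex.I * x * s) * Complex.exp (Complex.I * x * ((t - s : ℝ) : ℂ)) := by
    rw [← Complex.exp_add]; congr 1; push_cast; ring
  rw [this]; ring

lemma aux_transl (w : ℝ → ℂ) (hw : Integrable w) :
    Continuous (fun s : ℝ => ∫ t, ‖w t - w (t - s)‖) := by
  have hm : MemLp w 1 volume := memLp_one_iff_integrable.2 hw
  let g : ℝ → C(ℝ, ℝ) := fun s => ⟨fun t => t - s, by fun_prop⟩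
  have hg : Continuous g := by
    apply ContinuousMap.continuous_of_continuous_uncurry
    simp only [g]
    exact continuous_snd.sub continuous_fst
  have hgm : ∀ s, MeasurePreserving (g s) volume volume := fun s =>
    measurePreserving_sub_right volume s
  have h := (continuous_const (y := hm.toLp w)).compMeasurePreservingLp hg hgm (by norm_num)
  have h2 := (continuous_const (y := hm.toLp w)).sub h |>.norm
  convert h2 using 2 with s
  change _ = ‖hm.toLp w - Lp.compMeasurePreserving (g s) (hgm s) (hm.toLp w)‖
  rw [L1.norm_eq_integral_norm]
  apply integral_congr_ae
  filter_upwards [Lp.coeFn_sub (hm.toLp w) (Lp.compMeasurePreserving (g s) (hgm s) (hm.toLp w)),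
    hm.coeFn_toLp, Lp.coeFn_compMeasurePreserving (hm.toLp w) (hgm s),
    (hgm s).quasiMeasurePreserving.ae_eq_comp hm.coeFn_toLp] with t h1 h2 h3 h4
  rw [h1, Pi.sub_apply, h2, h3, h4]
  rfl

lemma aux_approx (a w : ℝ → ℂ) (ha : Integrable a) (hw : Integrable w) (h1 : ∫ t, a t = 1) :
    Tendsto (fun R : ℝ => ∫ t, ‖w t -
      ((fun s => (R : ℂ) * a (R * s)) ⋆[ContinuousLinearMap.mul ℝ ℂ] w) t‖) atTop (nhds 0) := by
  set ω : ℝ → ℝ := fun s : ℝ => ∫ t, ‖w t - w (t - s)‖ with hω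
  have hωc : Continuous ω := aux_transl w hw
  have hω0 : ω 0 = 0 := by simp [hω]
  have hωn : ∀ s, 0 ≤ ω s := fun s => integral_nonneg fun t => norm_nonneg _
  have hωb : ∀ s, ω s ≤ 2 * ∫ t, ‖w t‖ := by
    intro s
    calc ω s ≤ ∫ t, (‖w t‖ + ‖w (t - s)‖) := by
          apply integral_mono_of_nonneg (ae_of_all _ fun t => norm_nonneg _)
            (hw.norm.add (hw.norm.comp_sub_right s)) (ae_of_all _ fun t => norm_sub_le _ _)
      _ = _ := by
          rw [integral_add hw.norm (hw.norm.comp_sub_right s),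
            integral_sub_right_eq_self (fun t => ‖w t‖)]; ring
  have hbound : ∀ R : ℝ, 0 < R → ∫ t, ‖w t -
      ((fun s => (R : ℂ) * a (R * s)) ⋆[ContinuousLinearMap.mul ℝ ℂ] w) t‖ ≤
      ∫ s, ‖a s‖ * ω (R⁻¹ * s) := by
    intro R hR
    set b : ℝ → ℂ := fun s => (R : ℂ) * a (R * s) with hb
    have hbi : Integrable b := (ha.comp_mul_left' hR.ne').const_mul _
    have hb1 : ∫ s, b s = 1 := by
      rw [hb, integral_const_mul, Measure.integral_comp_mul_left, h1]
      simp [abs_of_pos hR, hR.ne']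
    have hp1 : Integrable (fun p : ℝ × ℝ => b p.2 * w (p.1 - p.2)) (volume.prod volume) :=
      hbi.convolution_integrand (ContinuousLinearMap.mul ℝ ℂ) hw
    have hp2 : Integrable (fun p : ℝ × ℝ => b p.2 * w p.1) (volume.prod volume) := by
      simpa [mul_comm] using hw.mul_prod hbi
    have hp3 : Integrable (fun p : ℝ × ℝ => b p.2 * (w p.1 - w (p.1 - p.2)))
        (volume.prod volume) := by
      convert hp2.sub hp1 using 2 with p
      simp [mul_sub]
    have hpt : ∀ᵐ t, ‖w t - (b ⋆[ContinuousLinearMap.mul ℝ ℂ] w) t‖ ≤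
        ∫ s, ‖b s * (w t - w (t - s))‖ := by
      filter_upwards [hp1.prod_right_ae] with t ht
      have : w t - (b ⋆[ContinuousLinearMap.mul ℝ ℂ] w) t = ∫ s, b s * (w t - w (t - s)) := by
        simp only [mul_sub, convolution_def, ContinuousLinearMap.mul_apply']
        rw [integral_sub (hbi.mul_const _) ht, integral_mul_const, hb1, one_mul]
      rw [this]
      exact norm_integral_le_integral_norm _
    calc _ ≤ ∫ t, ∫ s, ‖b s * (w t - w (t - s))‖ :=
          integral_mono_of_nonneg (ae_of_all _ fun t => norm_nonneg _)
            hp3.norm.integral_prod_left hpt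
      _ = ∫ s, ∫ t, ‖b s * (w t - w (t - s))‖ := integral_integral_swap hp3.norm
      _ = ∫ s, ‖b s‖ * ω s := by simp only [norm_mul, integral_const_mul, hω]
      _ = ∫ s, R * (‖a (R * s)‖ * ω (R⁻¹ * (R * s))) := by
          congr 1; ext s
          rw [inv_mul_cancel_left₀ hR.ne']
          simp [hb, abs_of_pos hR, mul_assoc]
      _ = _ := by
          rw [integral_const_mul, Measure.integral_comp_mul_left (fun s => ‖a s‖ * ω (R⁻¹ * s)) R]
          simp [abs_of_pos hR, hR.ne']
  have hlim : Tendsto (fun R : ℝ => ∫ s, ‖a s‖ * ω (R⁻¹ * s)) atTop (nhds (∫ s : ℝ, (0 : ℝ))) := by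
    apply tendsto_integral_filter_of_dominated_convergence (fun s => ‖a s‖ * (2 * ∫ t, ‖w t‖))
    · filter_upwards with R
      exact ha.norm.aestronglyMeasurable.mul
        (hωc.comp (continuous_const.mul continuous_id)).aestronglyMeasurable
    · filter_upwards with R
      refine ae_of_all _ fun s => ?_
      rw [norm_mul, norm_norm, Real.norm_of_nonneg (hωn _)]
      exact mul_le_mul_of_nonneg_left (hωb _) (norm_nonneg _)
    · exact ha.norm.mul_const _
    · refine ae_of_all _ fun s => ?_
      have : Tendsto (fun R : ℝ => R⁻¹ * s) atTop (nhds 0) := by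
        simpa using tendsto_inv_atTop_zero.mul_const s
      have h2 := (hωc.tendsto 0).comp this
      rw [hω0] at h2
      simpa using h2.const_mul ‖a s‖
  rw [integral_zero] at hlim
  refine squeeze_zero' (Eventually.of_forall fun R => integral_nonneg fun t => norm_nonneg _) ?_ hlim
  filter_upwards [eventually_gt_atTop 0] with R hR using hbound R hR

lemma aux_u (x : ℝ) : ‖(x : ℂ) - Complex.I‖ ^ 2 = 1 + x ^ 2 := by
  rw [← Complex.normSq_eq_norm_sq, Complex.normSq_apply]; simp; ring

lemma aux_u1 (x : ℝ) : 1 ≤ ‖(x : ℂ) - Complex.I‖ := by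
  have := aux_u x
  nlinarith [norm_nonneg ((x : ℂ) - Complex.I), sq_nonneg x]

lemma aux_H1 (φ : ℝ → ℂ) (hφ : ContDiff ℝ 1 φ) (hs : HasCompactSupport φ) (δ : ℝ) (hδ : 0 < δ)
    (h0 : ∀ x : ℝ, ‖φ x‖ * ‖(x : ℂ) - Complex.I‖ ≤ δ)
    (h1 : ∀ x : ℝ, ‖deriv φ x‖ * ‖(x : ℂ) - Complex.I‖ ≤ δ) :
    ∃ v : ℝ → ℂ, Integrable v ∧
      (∀ x : ℝ, φ x = ∫ t : ℝ, v t * Complex.exp (Complex.I * x * t)) ∧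
      ∫ t, ‖v t‖ ≤ 3 * Real.pi * δ := by
  have hφi : Integrable φ := hφ.continuous.integrable_of_hasCompactSupport hs
  have hdc : Continuous (deriv φ) := hφ.continuous_deriv le_rfl
  have hds : HasCompactSupport (deriv φ) := hs.deriv
  have hdi : Integrable (deriv φ) := hdc.integrable_of_hasCompactSupport hds
  obtain ⟨p1, p2⟩ := aux_planch φ hφ.continuous hs
  obtain ⟨q1, q2⟩ := aux_planch _ hdc hds
  have hFc : Continuous (𝓕 φ) :=
    VectorFourier.fourierIntegral_continuous Real.continuous_fourierChar continuous_inner hφi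
  have hb : ∀ ψ : ℝ → ℂ, (∀ x : ℝ, ‖ψ x‖ * ‖(x : ℂ) - Complex.I‖ ≤ δ) →
      ∫ x, ‖ψ x‖ ^ 2 ≤ Real.pi * δ ^ 2 := by
    intro ψ hψ
    calc ∫ x, ‖ψ x‖ ^ 2 ≤ ∫ x : ℝ, δ ^ 2 * (1 + x ^ 2)⁻¹ := by
          apply integral_mono_of_nonneg (ae_of_all _ fun t => by positivity)
            (integrable_inv_one_add_sq.const_mul _) (ae_of_all _ fun x => ?_)
          have hx := hψ x
          have : (‖ψ x‖ * ‖(x : ℂ) - Complex.I‖) ^ 2 ≤ δ ^ 2 := by gcongr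
          rw [mul_pow, aux_u] at this
          simp only
          rw [← div_eq_mul_inv, le_div_iff₀ (by positivity)]
          exact this
      _ = _ := by rw [integral_const_mul, integral_univ_inv_one_add_sq]; ring
  have hF : ∀ t, ‖𝓕 (deriv φ) t‖ ^ 2 = (2 * Real.pi * t) ^ 2 * ‖𝓕 φ t‖ ^ 2 := by
    intro t
    rw [Real.fourier_deriv hφi (hφ.differentiable one_ne_zero) hdi]
    simp only [norm_smul, norm_mul, mul_pow]
    simp [abs_of_pos Real.pi_pos]
  have hpt : ∀ t : ℝ, ‖𝓕 φ t‖ ≤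
      δ * (1 + t ^ 2)⁻¹ + δ⁻¹ * (‖𝓕 φ t‖ ^ 2 + ‖𝓕 (deriv φ) t‖ ^ 2) := by
    intro t
    rw [hF]
    set y := ‖𝓕 φ t‖ with hy
    have hy0 : 0 ≤ y := norm_nonneg _
    have hpi : 1 ≤ (2 * Real.pi) ^ 2 := by nlinarith [Real.pi_gt_three]
    have e1 : (1 + t ^ 2) * y ^ 2 ≤ y ^ 2 + (2 * Real.pi * t) ^ 2 * y ^ 2 := by
      have : t ^ 2 * y ^ 2 ≤ (2 * Real.pi) ^ 2 * (t ^ 2 * y ^ 2) :=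
        le_mul_of_one_le_left (by positivity) hpi
      nlinarith
    have e2 : y ≤ δ * (1 + t ^ 2)⁻¹ + δ⁻¹ * ((1 + t ^ 2) * y ^ 2) := by
      have hq : 0 < 1 + t ^ 2 := by positivity
      set z := (1 + t ^ 2) * y with hz
      have : y = z * (1 + t ^ 2)⁻¹ := by rw [hz]; field_simp
      have h3 : δ⁻¹ * ((1 + t ^ 2) * y ^ 2) = (δ⁻¹ * z ^ 2) * (1 + t ^ 2)⁻¹ := by
        rw [hz]; field_simp
      rw [h3, ← add_mul, this]
      apply mul_le_mul_of_nonneg_right _ (by positivity)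
      rw [← sub_nonneg]
      have : δ + δ⁻¹ * z ^ 2 - z = δ⁻¹ * (δ ^ 2 + z ^ 2 - δ * z) := by field_simp
      rw [this]
      have : 0 ≤ δ ^ 2 + z ^ 2 - δ * z := by nlinarith [sq_nonneg (δ - z), sq_nonneg (δ + z)]
      positivity
    refine e2.trans ?_
    gcongr
  have hdom : Integrable (fun t : ℝ =>
      δ * (1 + t ^ 2)⁻¹ + δ⁻¹ * (‖𝓕 φ t‖ ^ 2 + ‖𝓕 (deriv φ) t‖ ^ 2)) :=
    (integrable_inv_one_add_sq.const_mul _).add ((p1.add q1).const_mul _)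
  have hFi : Integrable (𝓕 φ) := by
    refine hdom.mono' hFc.aestronglyMeasurable (ae_of_all _ hpt)
  have hFb : ∫ t, ‖𝓕 φ t‖ ≤ 3 * Real.pi * δ := by
    calc _ ≤ _ := integral_mono hFi.norm hdom hpt
      _ = (∫ t : ℝ, δ * (1 + t ^ 2)⁻¹) +
          ∫ t : ℝ, δ⁻¹ * (‖𝓕 φ t‖ ^ 2 + ‖𝓕 (deriv φ) t‖ ^ 2) :=
        integral_add (integrable_inv_one_add_sq.const_mul _) ((p1.add q1).const_mul _)
      _ = δ * Real.pi + δ⁻¹ * ((∫ x, ‖φ x‖ ^ 2) + ∫ x, ‖deriv φ x‖ ^ 2) := by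
        rw [integral_const_mul, integral_const_mul, integral_add p1 q1, p2, q2,
          integral_univ_inv_one_add_sq]
      _ ≤ δ * Real.pi + δ⁻¹ * (Real.pi * δ ^ 2 + Real.pi * δ ^ 2) := by
        gcongr
        · exact hb _ h0
        · exact hb _ h1
      _ = _ := by field_simp; ring
  have hpi : (2 * Real.pi)⁻¹ ≠ 0 := by positivity
  refine ⟨fun t => ((2 * Real.pi)⁻¹ : ℝ) * 𝓕 φ ((2 * Real.pi)⁻¹ * t),
    (hFi.comp_mul_left' hpi).const_mul _, fun x => ?_, ?_⟩
  · have hinv := congrFun (hφ.continuous.fourierInv_fourier_eq hφi hFi) x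
    rw [← hinv, Real.fourierInv_eq']
    have e : ∀ t : ℝ, ((2 * Real.pi)⁻¹ : ℝ) * 𝓕 φ ((2 * Real.pi)⁻¹ * t) *
        Complex.exp (Complex.I * x * t) = ((2 * Real.pi)⁻¹ : ℝ) *
        ((fun s : ℝ => Complex.exp (((2 * Real.pi * inner ℝ s x : ℝ) : ℂ) * Complex.I) • 𝓕 φ s)
          ((2 * Real.pi)⁻¹ * t)) := by
      intro t
      have h : (((2 * Real.pi * inner ℝ ((2 * Real.pi)⁻¹ * t) x : ℝ) : ℂ) * Complex.I)
          = Complex.I * x * t := by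
        have : (2 * Real.pi * inner ℝ ((2 * Real.pi)⁻¹ * t) x : ℝ) = x * t := by
          simp; field_simp
        rw [this]; push_cast; ring
      simp only [h, smul_eq_mul]; ring
    simp_rw [e]
    rw [integral_const_mul, Measure.integral_comp_mul_left (fun s : ℝ =>
      Complex.exp (((2 * Real.pi * inner ℝ s x : ℝ) : ℂ) * Complex.I) • 𝓕 φ s)]
    rw [Complex.real_smul, ← mul_assoc, ← Complex.ofReal_mul, inv_inv,
      abs_of_pos (by positivity : 0 < 2 * Real.pi), inv_mul_cancel₀ (by positivity)]
    simp
  · simp only [norm_mul]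
    rw [integral_const_mul, Measure.integral_comp_mul_left (fun t => ‖𝓕 φ t‖), inv_inv, smul_eq_mul,
      ← mul_assoc, Complex.norm_real, Real.norm_of_nonneg (by positivity),
      abs_of_pos (by positivity : 0 < 2 * Real.pi), inv_mul_cancel₀ (by positivity), one_mul]
    exact hFb

lemma aux_wit (φ : ℝ → ℂ) (hφ : ContDiff ℝ 1 φ) (hs : HasCompactSupport φ) :
    ∃ v : ℝ → ℂ, Integrable v ∧
      (∀ x : ℝ, φ x = ∫ t : ℝ, v t * Complex.exp (Complex.I * x * t)) := by
  have key : ∀ ψ : ℝ → ℂ, Continuous ψ → HasCompactSupport ψ →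
      ∃ C : ℝ, ∀ x : ℝ, ‖ψ x‖ * ‖(x : ℂ) - Complex.I‖ ≤ C := by
    intro ψ hc hs
    have h := (hs.mul_right (f' := fun x : ℝ => (x : ℂ) - Complex.I)).exists_bound_of_continuous
      (by fun_prop)
    simpa using h
  obtain ⟨C, hC⟩ := key φ hφ.continuous hs
  obtain ⟨D, hD⟩ := key (deriv φ) (hφ.continuous_deriv le_rfl) hs.deriv
  obtain ⟨v, hv, hv2, -⟩ := aux_H1 φ hφ hs (|C| + |D| + 1) (by positivity)
    (fun x => (hC x).trans (by linarith [le_abs_self C, abs_nonneg D]))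
    (fun x => (hD x).trans (by linarith [le_abs_self D, abs_nonneg C]))
  exact ⟨v, hv, hv2⟩

lemma aux_chi : ∃ χ : ℝ → ℂ, (∀ n : ℕ, ContDiff ℝ n χ) ∧ HasCompactSupport χ ∧
    (∀ x, |x| ≤ 1 → χ x = 1) ∧ (∀ x, ‖1 - χ x‖ ≤ 1) := by
  let b : ContDiffBump (0 : ℝ) := ⟨1, 2, one_pos, one_lt_two⟩
  refine ⟨fun x => (b x : ℂ), fun n => ?_, ?_, fun x hx => ?_, fun x => ?_⟩
  · exact Complex.ofRealCLM.contDiff.comp b.contDiff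
  · exact b.hasCompactSupport.comp_left (g := fun y : ℝ => (y : ℂ)) (by simp)
  · have : b x = 1 := b.one_of_mem_closedBall (by simpa [b] using hx)
    simp [this]
  · have h1 : b x ≤ 1 := b.le_one
    have h0 : 0 ≤ b x := b.nonneg
    have : (1 : ℂ) - (b x : ℂ) = ((1 - b x : ℝ) : ℂ) := by push_cast; rfl
    simp only [this, Complex.norm_real, Real.norm_eq_abs]
    rw [abs_le]; constructor <;> linarith

lemma aux_cs (φ : ℝ → ℂ) (hs : HasCompactSupport φ) (k : ℕ) :
    HasCompactSupport (iteratedDeriv k φ) := by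
  induction k with
  | zero => simpa using hs
  | succ k ih => rw [iteratedDeriv_succ]; exact ih.deriv

lemma aux_cd (φ : ℝ → ℂ) (n k m : ℕ) (h : ContDiff ℝ n φ) (hk : m + k ≤ n) :
    ContDiff ℝ m (iteratedDeriv k φ) := by
  rw [iteratedDeriv_eq_iterate]
  exact ContDiff.iterate_deriv' m k (h.of_le (by exact_mod_cast hk))

lemma aux_scale (χ : ℝ → ℂ) (h : ∀ n : ℕ, ContDiff ℝ n χ) (hs : HasCompactSupport χ)
    (h1 : ∀ x, |x| ≤ 1 → χ x = 1) (k : ℕ) : ∃ C : ℝ, ∀ R : ℝ, 1 ≤ R →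
      (∀ x : ℝ, ‖iteratedDeriv k (fun y => χ (R⁻¹ * y)) x‖ * ‖(x : ℂ) - Complex.I‖ ^ k ≤ C) ∧
      (1 ≤ k → ∀ x : ℝ, |x| < R → iteratedDeriv k (fun y => χ (R⁻¹ * y)) x = 0) := by
  have hb := ((aux_cs χ hs k).mul_right
    (f' := fun x : ℝ => ((|x| + 1 : ℝ) : ℂ) ^ k)).exists_bound_of_continuous
      (((h k).continuous_iteratedDeriv').mul (by fun_prop))
  obtain ⟨C, hC⟩ := hb
  refine ⟨C, fun R hR => ⟨fun x => ?_, fun hk x hx => ?_⟩⟩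
  · have hR0 : 0 < R := by linarith
    rw [iteratedDeriv_comp_const_smul (h k)]
    refine le_trans ?_ (hC (R⁻¹ * x))
    simp only [Pi.mul_apply, norm_mul, norm_smul, norm_pow, Complex.norm_real, Real.norm_eq_abs]
    rw [abs_of_pos (inv_pos.2 hR0), abs_of_nonneg (by positivity : 0 ≤ |R⁻¹ * x| + 1)]
    have : ‖(x : ℂ) - Complex.I‖ ≤ R * (|R⁻¹ * x| + 1) := by
      rw [abs_mul, abs_of_pos (inv_pos.2 hR0), mul_add, mul_inv_cancel_left₀ hR0.ne']
      have := norm_sub_le (x : ℂ) Complex.I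
      simp at this
      linarith
    calc _ ≤ R⁻¹ ^ k * ‖iteratedDeriv k χ (R⁻¹ * x)‖ * (R * (|R⁻¹ * x| + 1)) ^ k := by gcongr
      _ = _ := by rw [mul_pow, inv_pow]; field_simp
  · have hR0 : 0 < R := by linarith
    have : (fun y => χ (R⁻¹ * y)) =ᶠ[nhds x] fun _ => 1 := by
      have : ∀ᶠ y in nhds x, |y| < R := (isOpen_lt continuous_abs continuous_const).mem_nhds hx
      filter_upwards [this] with y hy
      apply h1
      rw [abs_mul, abs_of_pos (inv_pos.2 hR0), inv_mul_le_iff₀ hR0]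
      linarith
    rw [this.iteratedDeriv_eq]
    simp [iteratedDeriv_const, show k ≠ 0 by omega]

lemma aux_est (n : ℕ) (hn : 1 ≤ n) (f X : ℝ → ℂ) (hf : ContDiff ℝ n f)
    (hX : ∀ m : ℕ, ContDiff ℝ m X) (D : ℝ)
    (hT : ∀ i ≤ n, ∀ k, 1 ≤ k → k ≤ n + 1 → ∀ x : ℝ,
      ‖iteratedDeriv i f x‖ * ‖iteratedDeriv k X x‖ * ‖(x : ℂ) - Complex.I‖ ^ (i + k) ≤ D)
    (h0 : ∀ i ≤ n, ∀ x : ℝ,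
      ‖iteratedDeriv i f x‖ * ‖1 - X x‖ * ‖(x : ℂ) - Complex.I‖ ^ i ≤ D) :
    (∀ p ≤ n, ∀ x : ℝ, ‖(iteratedDeriv p f x - iteratedDeriv p (f * X) x) *
      ((x : ℂ) - Complex.I) ^ p‖ ≤ 2 ^ p * D) ∧
    ∃ E : ℝ → ℂ, ContDiff ℝ 1 E ∧
      (∀ x, iteratedDeriv n (f * X) x = iteratedDeriv n f x * X x + E x) ∧
      (∀ x : ℝ, ‖E x‖ * ‖(x : ℂ) - Complex.I‖ ≤ 2 ^ (n + 1) * D) ∧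
      (∀ x : ℝ, ‖deriv E x‖ * ‖(x : ℂ) - Complex.I‖ ≤ 2 ^ (n + 1) * D) := by
  have hD : 0 ≤ D := le_trans (by positivity) (h0 0 (by omega) 0)
  have hleib : ∀ p ≤ n, ∀ x, iteratedDeriv p (f * X) x = ∑ i ∈ Finset.range p,
      (p.choose i : ℂ) * iteratedDeriv i f x * iteratedDeriv (p - i) X x
      + iteratedDeriv p f x * X x := by
    intro p hp x
    rw [iteratedDeriv_mul ((hf.of_le (by exact_mod_cast hp)).contDiffAt) (hX p).contDiffAt,
      Finset.sum_range_succ]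
    simp
  have hchoose : ∀ p : ℕ, ∑ i ∈ Finset.range p, (p.choose i : ℝ) * D + D = 2 ^ p * D := by
    intro p
    have := Nat.sum_range_choose p
    rw [Finset.sum_range_succ, Nat.choose_self] at this
    rw [← Finset.sum_mul]
    have h : (∑ i ∈ Finset.range p, (p.choose i : ℝ)) + 1 = 2 ^ p := by exact_mod_cast this
    rw [← h]; ring
  refine ⟨fun p hp x => ?_, ?_⟩
  · rw [hleib p hp x, ← hchoose p]
    set U := (x : ℂ) - Complex.I with hU
    have e : (iteratedDeriv p f x - (∑ i ∈ Finset.range p,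
      (p.choose i : ℂ) * iteratedDeriv i f x * iteratedDeriv (p - i) X x
      + iteratedDeriv p f x * X x)) * U ^ p = -(∑ i ∈ Finset.range p,
      (p.choose i : ℂ) * iteratedDeriv i f x * iteratedDeriv (p - i) X x * U ^ p)
      + iteratedDeriv p f x * (1 - X x) * U ^ p := by
      rw [← Finset.sum_mul]; ring
    rw [e]
    refine (norm_add_le _ _).trans (add_le_add ?_ ?_)
    · rw [norm_neg]
      refine (norm_sum_le _ _).trans (Finset.sum_le_sum fun i hi => ?_)
      have hi' := Finset.mem_range.1 hi
      have := hT i (by omega) (p - i) (by omega) (by omega) x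
      rw [show i + (p - i) = p by omega] at this
      simp only [norm_mul, norm_pow, Complex.norm_natCast]
      calc _ = (p.choose i : ℝ) * (‖iteratedDeriv i f x‖ * ‖iteratedDeriv (p - i) X x‖ * ‖U‖ ^ p) := by
            ring
        _ ≤ _ := by gcongr
    · simp only [norm_mul, norm_pow]
      exact h0 p hp x
  · have hd : ∀ x, HasDerivAt (fun x => ∑ i ∈ Finset.range n,
      (n.choose i : ℂ) * iteratedDeriv i f x * iteratedDeriv (n - i) X x)
      (∑ i ∈ Finset.range n, ((n.choose i : ℂ) * iteratedDeriv (i + 1) f x * iteratedDeriv (n - i) X x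
        + (n.choose i : ℂ) * iteratedDeriv i f x * iteratedDeriv (n - i + 1) X x)) x := by
      intro x
      apply HasDerivAt.fun_sum
      intro i hi
      have hi' := Finset.mem_range.1 hi
      have a1 : HasDerivAt (iteratedDeriv i f) (iteratedDeriv (i + 1) f x) x := by
        rw [iteratedDeriv_succ]
        exact (hf.differentiable_iteratedDeriv i (by exact_mod_cast hi') x).hasDerivAt
      have a2 : HasDerivAt (iteratedDeriv (n - i) X) (iteratedDeriv (n - i + 1) X x) x := by
        rw [iteratedDeriv_succ]
        exact ((hX (n - i + 1)).differentiable_iteratedDeriv (n - i)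
          (by exact_mod_cast Nat.lt_succ_self _) x).hasDerivAt
      exact (a1.const_mul _).mul a2
    have hone : ∀ x : ℝ, ‖(x : ℂ) - Complex.I‖ ≤ ‖(x : ℂ) - Complex.I‖ ^ n := fun x =>
      le_self_pow₀ (aux_u1 x) (by omega)
    have hone' : ∀ x : ℝ, ‖(x : ℂ) - Complex.I‖ ≤ ‖(x : ℂ) - Complex.I‖ ^ (n + 1) := fun x =>
      le_self_pow₀ (aux_u1 x) (by omega)
    have hterm : ∀ i ≤ n, ∀ k, 1 ≤ k → k ≤ n + 1 → 1 ≤ i + k → ∀ c : ℕ, ∀ x : ℝ,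
        ‖(c : ℂ) * iteratedDeriv i f x * iteratedDeriv k X x‖ * ‖(x : ℂ) - Complex.I‖ ≤ c * D := by
      intro i hi k hk hk' hik c x
      have h2 : ‖(x : ℂ) - Complex.I‖ ≤ ‖(x : ℂ) - Complex.I‖ ^ (i + k) :=
        le_self_pow₀ (aux_u1 x) (by omega)
      simp only [norm_mul, Complex.norm_natCast]
      calc _ ≤ (c : ℝ) * ‖iteratedDeriv i f x‖ * ‖iteratedDeriv k X x‖ *
            ‖(x : ℂ) - Complex.I‖ ^ (i + k) := by gcongr
        _ = (c : ℝ) * (‖iteratedDeriv i f x‖ * ‖iteratedDeriv k X x‖ *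
            ‖(x : ℂ) - Complex.I‖ ^ (i + k)) := by ring
        _ ≤ _ := by gcongr; exact hT i hi k hk hk' x
    refine ⟨fun x => ∑ i ∈ Finset.range n,
      (n.choose i : ℂ) * iteratedDeriv i f x * iteratedDeriv (n - i) X x, ?_, ?_, ?_, ?_⟩
    · apply ContDiff.sum
      intro i hi
      have hi' := Finset.mem_range.1 hi
      exact (contDiff_const.mul (aux_cd f n i 1 hf (by omega))).mul
        (aux_cd X (1 + (n - i)) (n - i) 1 (hX _) le_rfl)
    · intro x
      rw [hleib n le_rfl x]; ring
    · intro x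
      calc _ ≤ (∑ i ∈ Finset.range n,
            ‖(n.choose i : ℂ) * iteratedDeriv i f x * iteratedDeriv (n - i) X x‖) *
            ‖(x : ℂ) - Complex.I‖ := by gcongr; exact norm_sum_le _ _
        _ ≤ ∑ i ∈ Finset.range n, (n.choose i : ℝ) * D := by
            rw [Finset.sum_mul]
            refine Finset.sum_le_sum fun i hi => ?_
            have hi' := Finset.mem_range.1 hi
            exact hterm i (by omega) (n - i) (by omega) (by omega) (by omega) _ x
        _ ≤ 2 ^ n * D := by rw [← hchoose n]; linarith
        _ ≤ _ := by gcongr <;> norm_num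
    · intro x
      rw [(hd x).deriv]
      calc _ ≤ (∑ i ∈ Finset.range n,
            (‖(n.choose i : ℂ) * iteratedDeriv (i + 1) f x * iteratedDeriv (n - i) X x‖ +
            ‖(n.choose i : ℂ) * iteratedDeriv i f x * iteratedDeriv (n - i + 1) X x‖)) *
            ‖(x : ℂ) - Complex.I‖ := by
              gcongr
              exact (norm_sum_le _ _).trans (Finset.sum_le_sum fun i hi => norm_add_le _ _)
        _ ≤ ∑ i ∈ Finset.range n, ((n.choose i : ℝ) * D + (n.choose i : ℝ) * D) := by
            rw [Finset.sum_mul]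
            refine Finset.sum_le_sum fun i hi => ?_
            have hi' := Finset.mem_range.1 hi
            rw [add_mul]
            exact add_le_add (hterm (i + 1) (by omega) (n - i) (by omega) (by omega) (by omega) _ x)
              (hterm i (by omega) (n - i + 1) (by omega) (by omega) (by omega) _ x)
        _ ≤ 2 * (2 ^ n * D) := by rw [← hchoose n, Finset.sum_add_distrib]; linarith
        _ = _ := by ring

lemma aux_exp_int (a : ℝ → ℂ) (ha : Integrable a) (x : ℝ) :
    Integrable (fun t : ℝ => a t * Complex.exp (Complex.I * x * t)) := by
  refine ha.mul_bdd (c := 1) (by fun_prop) (ae_of_all _ fun t => ?_)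
  rw [Complex.norm_exp]; simp

theorem stmt5 (n : ℕ) (hn : 1 ≤ n) (f : ℝ → ℂ) (hf : ContDiff ℝ n f)
    (hC0 : ∀ p ≤ n, Tendsto (fun x : ℝ => iteratedDeriv p f x * ((x : ℂ) - Complex.I) ^ p)
      (cocompact ℝ) (nhds 0))
    (w : ℝ → ℂ) (hw : Integrable w)
    (hwrep : ∀ x : ℝ, iteratedDeriv n f x = ∫ t : ℝ, w t * Complex.exp (Complex.I * x * t))
    (ε : ℝ) (hε : 0 < ε) :
    ∃ g v : ℝ → ℂ,
      ContDiff ℝ n g ∧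
      (∀ p ≤ n, Tendsto (fun x : ℝ => iteratedDeriv p g x * ((x : ℂ) - Complex.I) ^ p)
        (cocompact ℝ) (nhds 0)) ∧
      (∀ p ≤ n, ∃ vp : ℝ → ℂ, Integrable vp ∧ ∀ x : ℝ,
        iteratedDeriv p g x * ((x : ℂ) - Complex.I) ^ p =
          ∫ t : ℝ, vp t * Complex.exp (Complex.I * x * t)) ∧
      Integrable v ∧
      (∀ x : ℝ, iteratedDeriv n g x = ∫ t : ℝ, v t * Complex.exp (Complex.I * x * t)) ∧
      (∑ p ∈ Finset.range (n + 1),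
          ⨆ x : ℝ, ‖(iteratedDeriv p f x - iteratedDeriv p g x) * ((x : ℂ) - Complex.I) ^ p‖)
        + (∫ t : ℝ, ‖w t - v t‖) < ε := by
  obtain ⟨χ, hχ, hχs, hχ1, hχb⟩ := aux_chi
  obtain ⟨a, ha, harep⟩ := aux_wit χ (by exact_mod_cast hχ 1) hχs
  have ha1 : ∫ t, a t = 1 := by
    have := harep 0
    rw [hχ1 0 (by simp)] at this
    simpa using this.symm
  choose C hC using aux_scale χ hχ hχs hχ1
  set M : ℝ := ∑ k ∈ Finset.range (n + 2), |C k| + 1 with hM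
  have hM1 : 1 ≤ M := by
    have : 0 ≤ ∑ k ∈ Finset.range (n + 2), |C k| := Finset.sum_nonneg fun _ _ => abs_nonneg _
    linarith
  have hCM : ∀ k ≤ n + 1, C k ≤ M := by
    intro k hk
    have := Finset.single_le_sum (f := fun k => |C k|) (fun i _ => abs_nonneg (C i))
      (Finset.mem_range.2 (show k < n + 2 by omega))
    linarith [le_abs_self (C k)]
  set L : ℝ := (n + 1) * 2 ^ n + 3 * Real.pi * 2 ^ (n + 1) with hL
  have hL0 : 0 < L := by positivity
  set δ : ℝ := ε / (2 * (L * M)) with hδ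
  have hM0 : 0 < M := by linarith
  have hδ0 : 0 < δ := by positivity
  have hev : ∀ i ≤ n, ∀ᶠ R : ℝ in atTop, ∀ x : ℝ, R ≤ |x| →
      ‖iteratedDeriv i f x‖ * ‖(x : ℂ) - Complex.I‖ ^ i ≤ δ := by
    intro i hi
    have h1 := (hC0 i hi).norm
    rw [norm_zero] at h1
    have h2 := h1.eventually (ge_mem_nhds hδ0)
    rw [← Metric.cobounded_eq_cocompact, ← comap_norm_atTop, eventually_comap, eventually_atTop] at h2
    obtain ⟨R0, hR0⟩ := h2
    filter_upwards [eventually_ge_atTop R0] with R hR x hx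
    have := hR0 |x| (hR.trans hx) x rfl
    simpa using this
  have hev2 : ∀ᶠ R : ℝ in atTop, ∀ i ∈ Finset.range (n + 1), ∀ x : ℝ, R ≤ |x| →
      ‖iteratedDeriv i f x‖ * ‖(x : ℂ) - Complex.I‖ ^ i ≤ δ := by
    rw [Filter.eventually_all_finset]
    intro i hi
    exact hev i (by have := Finset.mem_range.1 hi; omega)
  have hev3 := (aux_approx a w ha hw ha1).eventually (gt_mem_nhds (half_pos hε))
  obtain ⟨R, hR1, hRf, hRa⟩ := ((eventually_ge_atTop 1).and (hev2.and hev3)).exists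
  have hR0 : 0 < R := by linarith
  set X : ℝ → ℂ := fun y => χ (R⁻¹ * y) with hX
  have hXc : ∀ m : ℕ, ContDiff ℝ m X := fun m => (hχ m).comp (contDiff_const.mul contDiff_id)
  have hXs : HasCompactSupport X := hχs.comp_homeomorph (Homeomorph.mulLeft₀ R⁻¹ (by positivity))
  have hX1 : ∀ x, |x| < R → X x = 1 := by
    intro x hx
    apply hχ1
    rw [abs_mul, abs_of_pos (inv_pos.2 hR0), inv_mul_le_iff₀ hR0]
    linarith
  obtain ⟨e1, E, hE1, hEg, hE0, hEd⟩ := aux_est n hn f X hf hXc (δ * M)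
    (by
      intro i hi k hk hk' x
      rcases lt_or_ge |x| R with hx | hx
      · rw [(hC k R hR1).2 hk x hx]; simp; positivity
      · have q1 := hRf i (Finset.mem_range.2 (by omega)) x hx
        have q2 := ((hC k R hR1).1 x).trans (hCM k hk')
        calc _ = (‖iteratedDeriv i f x‖ * ‖(x : ℂ) - Complex.I‖ ^ i) *
              (‖iteratedDeriv k X x‖ * ‖(x : ℂ) - Complex.I‖ ^ k) := by rw [pow_add]; ring
          _ ≤ _ := by gcongr)
    (by
      intro i hi x
      rcases lt_or_ge |x| R with hx | hx
      · rw [hX1 x hx]; simp; positivity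
      · have q1 := hRf i (Finset.mem_range.2 (by omega)) x hx
        have q2 : ‖1 - X x‖ ≤ M := (hχb _).trans hM1
        calc _ = (‖iteratedDeriv i f x‖ * ‖(x : ℂ) - Complex.I‖ ^ i) * ‖1 - X x‖ := by ring
          _ ≤ _ := by gcongr)
  have hgc : ContDiff ℝ n (f * X) := hf.mul (hXc n)
  have hgs : HasCompactSupport (f * X) := hXs.mul_left
  have hEs : HasCompactSupport E := by
    have h1 : HasCompactSupport (fun x => iteratedDeriv n (f * X) x + -(iteratedDeriv n f x * X x)) :=
      (aux_cs _ hgs n).add (hXs.mul_left (f := iteratedDeriv n f)).neg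
    have : E = (fun x => iteratedDeriv n (f * X) x + -(iteratedDeriv n f x * X x)) := by
      ext x; rw [hEg x]; ring
    rw [this]; exact h1
  obtain ⟨e, he, herep, heb⟩ := aux_H1 E hE1 hEs (2 ^ (n + 1) * (δ * M)) (by positivity) hE0 hEd
  set b : ℝ → ℂ := fun s => (R : ℂ) * a (R * s) with hb
  have hbi : Integrable b := (ha.comp_mul_left' hR0.ne').const_mul _
  have hbrep : ∀ x : ℝ, ∫ t : ℝ, b t * Complex.exp (Complex.I * x * t) = X x := by
    intro x
    rw [hX]
    simp only
    rw [harep]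
    have : ∀ t : ℝ, b t * Complex.exp (Complex.I * x * t) = (R : ℂ) * ((fun s : ℝ =>
        a s * Complex.exp (Complex.I * ((R⁻¹ * x : ℝ) : ℂ) * s)) (R * t)) := by
      intro t
      have : Complex.I * ((R⁻¹ * x : ℝ) : ℂ) * ((R * t : ℝ) : ℂ) = Complex.I * x * t := by
        have hRc : (R : ℂ) ≠ 0 := by exact_mod_cast hR0.ne'
        push_cast; field_simp
      simp only [this, hb]; ring
    rw [integral_congr_ae (ae_of_all _ this), integral_const_mul,
      Measure.integral_comp_mul_left (fun s : ℝ =>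
        a s * Complex.exp (Complex.I * ((R⁻¹ * x : ℝ) : ℂ) * s)),
      Complex.real_smul, ← mul_assoc, ← Complex.ofReal_mul, abs_of_pos (inv_pos.2 hR0),
      mul_inv_cancel₀ hR0.ne']
    simp
  obtain ⟨hci, hcrep⟩ := aux_conv b w hbi hw
  have hu : ∀ p m : ℕ, ContDiff ℝ m (fun x : ℝ => ((x : ℂ) - Complex.I) ^ p) := fun p m =>
    ((Complex.ofRealCLM.contDiff).sub contDiff_const).pow p
  refine ⟨f * X, fun t => (b ⋆[ContinuousLinearMap.mul ℝ ℂ] w) t + e t, hgc, ?_, ?_, hci.add he, ?_, ?_⟩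
  · intro p hp
    exact ((aux_cs _ hgs p).mul_right
      (f' := fun x : ℝ => ((x : ℂ) - Complex.I) ^ p)).is_zero_at_infty
  · intro p hp
    rcases hp.lt_or_eq with hp | rfl
    · exact aux_wit _ ((aux_cd _ n p 1 hgc (by omega)).mul (by exact_mod_cast hu p 1))
        ((aux_cs _ hgs p).mul_right (f' := fun x : ℝ => ((x : ℂ) - Complex.I) ^ p))
    · obtain ⟨c1, hc1, hc1r⟩ := aux_wit (fun x => X x * ((x : ℂ) - Complex.I) ^ p)
        ((by exact_mod_cast hXc 1 : ContDiff ℝ 1 X).mul (by exact_mod_cast hu p 1)) hXs.mul_right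
      obtain ⟨c2, hc2, hc2r⟩ := aux_wit (fun x => E x * ((x : ℂ) - Complex.I) ^ p)
        (hE1.mul (by exact_mod_cast hu p 1)) hEs.mul_right
      obtain ⟨hdi, hdrep⟩ := aux_conv c1 w hc1 hw
      refine ⟨fun t => (c1 ⋆[ContinuousLinearMap.mul ℝ ℂ] w) t + c2 t, hdi.add hc2, fun x => ?_⟩
      simp only [add_mul]
      rw [integral_add (aux_exp_int _ hdi x) (aux_exp_int _ hc2 x), hdrep, ← hc1r, ← hc2r, ← hwrep,
        hEg]
      ring
  · intro x
    simp only [add_mul]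
    rw [integral_add (aux_exp_int _ hci x) (aux_exp_int _ he x), hcrep, hbrep, ← hwrep, ← herep, hEg]
    ring
  · have s1 : ∑ p ∈ Finset.range (n + 1), (⨆ x : ℝ, ‖(iteratedDeriv p f x -
        iteratedDeriv p (f * X) x) * ((x : ℂ) - Complex.I) ^ p‖) ≤ (n + 1) * 2 ^ n * (δ * M) := by
      calc _ ≤ ∑ p ∈ Finset.range (n + 1), 2 ^ n * (δ * M) := by
            refine Finset.sum_le_sum fun p hp => ?_
            have hp' : p ≤ n := by have := Finset.mem_range.1 hp; omega
            refine ciSup_le fun x => (e1 p hp' x).trans ?_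
            gcongr
            norm_num
        _ = _ := by simp; ring
    have s2 : ∫ t, ‖w t - ((b ⋆[ContinuousLinearMap.mul ℝ ℂ] w) t + e t)‖ ≤
        (∫ t, ‖w t - (b ⋆[ContinuousLinearMap.mul ℝ ℂ] w) t‖) + ∫ t, ‖e t‖ := by
      have i1 : Integrable (fun t => ‖w t - (b ⋆[ContinuousLinearMap.mul ℝ ℂ] w) t‖) :=
        (hw.sub hci).norm
      rw [← integral_add i1 he.norm]
      refine integral_mono (hw.sub (hci.add he)).norm (i1.add he.norm) fun t => ?_
      simp only [Pi.add_apply, Pi.sub_apply]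
      rw [← sub_sub]
      exact norm_sub_le _ _
    have s3 : (n + 1) * 2 ^ n * (δ * M) + 3 * Real.pi * (2 ^ (n + 1) * (δ * M)) = ε / 2 := by
      have : (n + 1) * 2 ^ n * (δ * M) + 3 * Real.pi * (2 ^ (n + 1) * (δ * M)) = L * M * δ := by
        rw [hL]; ring
      rw [this, hδ]; field_simp
    linarith
end

section
/- Let n ≥ 1, let V be a trigonometric potential on T^n with frequency set F and coefficients (c_b), let b ∈ ℤ^n, and let V_b be the trigonometric potential with frequency set F ∩ {b,−b} and the same coefficients there. Let δ > 0. Then there exists D > 0 such that: for every (q₀,p₀) ∈ T^n × ℝ^n with |b·p₀| > D, and for all continuous curves (q,p) and (q̃,p̃) on [0,1] that solve Hamilton's equations with force fields −∇V and −∇(V−V_b) respectively and with common initial datum (q₀,p₀), one has d((q(1),p(1)), (q̃(1),p̃(1))) < δ, where d is the canonical distance on T^n × ℝ^n. -/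
noncomputable section

open MeasureTheory

/-- The canonical distance on `Tⁿ × ℝⁿ`, expressed on the covering space `ℝⁿ × ℝⁿ`
(points are represented by arbitrary lifts):
`d((x,p),(x',p')) = inf_{m ∈ ℤⁿ} ‖(x − x' − m, p − p')‖`, Euclidean norm on `ℝ²ⁿ`. -/
def torusDist {n : ℕ} (a b : (Fin n → ℝ) × (Fin n → ℝ)) : ℝ :=
  ⨅ m : Fin n → ℤ,
    Real.sqrt ((∑ i, (a.1 i - b.1 i - (m i : ℝ)) ^ 2) + ∑ i, (a.2 i - b.2 i) ^ 2)

/-- The `a`-th summand of (minus) the force field `−∇V` of a trigonometric potential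
`V = Σ_{a∈F} c_a e_a` on `Tⁿ` (as a function on the cover `ℝⁿ`):
`2πi·c_a·e^{2πi a·x}`. -/
def forceTerm {n : ℕ} (c : (Fin n → ℤ) → ℂ) (a : Fin n → ℤ) (x : Fin n → ℝ) : ℂ :=
  2 * Real.pi * Complex.I * c a *
    Complex.exp (2 * Real.pi * Complex.I * ∑ j, (a j : ℂ) * (x j : ℂ))

lemma aux_ftc {E : Type*} [NormedAddCommGroup E] [NormedSpace ℝ E] [CompleteSpace E]
    (f g : ℝ → E) (c : E) (hg : ContinuousOn g (Set.Icc 0 1))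
    (h : ∀ t ∈ Set.Icc (0 : ℝ) 1, f t = c + ∫ s in (0 : ℝ)..t, g s) :
    ∀ t ∈ Set.Ico (0 : ℝ) 1, HasDerivWithinAt f (g t) (Set.Ici t) t := by
  intro t ht
  have h01 : (0 : ℝ) ≤ 1 := zero_le_one
  set k : ℝ → E := Set.IccExtend h01 (Set.domRestrict (Set.Icc 0 1) g) with hk
  have hkc : Continuous k := (continuousOn_iff_continuous_domRestrict.1 hg).Icc_extend'
  have hkg : ∀ s ∈ Set.Icc (0 : ℝ) 1, k s = g s := by
    intro s hs
    rw [hk, Set.IccExtend_of_mem _ _ hs]; rfl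
  have hd : HasDerivAt (fun t => c + ∫ s in (0 : ℝ)..t, k s) (k t) t :=
    (intervalIntegral.integral_hasDerivAt_right (hkc.intervalIntegrable _ _)
      hkc.stronglyMeasurable.stronglyMeasurableAtFilter hkc.continuousAt).const_add c
  have htI : t ∈ Set.Icc (0 : ℝ) 1 := ⟨ht.1, ht.2.le⟩
  rw [hkg t htI] at hd
  have heq : ∀ s ∈ Set.Icc (0 : ℝ) 1, f s = c + ∫ s in (0 : ℝ)..s, k s := by
    intro s hs
    rw [h s hs]
    congr 1
    apply intervalIntegral.integral_congr
    intro r hr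
    rw [Set.uIcc_of_le hs.1] at hr
    exact (hkg r ⟨hr.1, hr.2.trans hs.2⟩).symm
  have h1 : HasDerivWithinAt f (g t) (Set.Icc 0 1) t :=
    (hd.hasDerivWithinAt).congr heq (heq t htI)
  have h2 : HasDerivWithinAt f (g t) (Set.Icc t 1) t :=
    h1.mono (Set.Icc_subset_Icc_left ht.1)
  exact h2.mono_of_mem_nhdsWithin (Icc_mem_nhdsGE ht.2)

def auxDot {n : ℕ} (a : Fin n → ℤ) (v : Fin n → ℝ) : ℝ := ∑ j, (a j : ℝ) * v j

def auxN {n : ℕ} (a : Fin n → ℤ) : ℝ := ∑ j, |(a j : ℝ)|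

def auxE {n : ℕ} (a : Fin n → ℤ) (x : Fin n → ℝ) : ℂ :=
  Complex.exp (Complex.I * ((2 * Real.pi * auxDot a x : ℝ) : ℂ))

def auxR {n : ℕ} (c : (Fin n → ℤ) → ℂ) (a : Fin n → ℤ) (x : Fin n → ℝ) : ℝ :=
  (-(2 * Real.pi * Complex.I * c a * auxE a x)).re

def auxS {n : ℕ} (c : (Fin n → ℤ) → ℂ) (a : Fin n → ℤ) (x : Fin n → ℝ) : ℝ :=
  (-(c a * auxE a x)).re

lemma auxN_nonneg {n : ℕ} (a : Fin n → ℤ) : 0 ≤ auxN a :=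
  Finset.sum_nonneg fun _ _ => abs_nonneg _

lemma auxN_coord {n : ℕ} (a : Fin n → ℤ) (i : Fin n) : |(a i : ℝ)| ≤ auxN a :=
  Finset.single_le_sum (f := fun j => |(a j : ℝ)|) (fun _ _ => abs_nonneg _) (Finset.mem_univ i)

lemma auxDot_le {n : ℕ} (a : Fin n → ℤ) (v : Fin n → ℝ) : |auxDot a v| ≤ auxN a * ‖v‖ := by
  unfold auxDot auxN
  rw [Finset.sum_mul]
  refine (Finset.abs_sum_le_sum_abs _ _).trans (Finset.sum_le_sum fun j _ => ?_)
  rw [abs_mul]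
  exact mul_le_mul_of_nonneg_left (norm_le_pi_norm v j) (abs_nonneg _)

lemma auxDot_sub {n : ℕ} (a : Fin n → ℤ) (v w : Fin n → ℝ) :
    auxDot a (v - w) = auxDot a v - auxDot a w := by
  simp [auxDot, mul_sub]

lemma auxDot_neg {n : ℕ} (a : Fin n → ℤ) (v : Fin n → ℝ) :
    auxDot (-a) v = - auxDot a v := by
  simp [auxDot]

lemma aux_force {n : ℕ} (c : (Fin n → ℤ) → ℂ) (a : Fin n → ℤ) (x : Fin n → ℝ) :
    forceTerm c a x = 2 * Real.pi * Complex.I * c a * auxE a x := by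
  unfold forceTerm auxE auxDot
  congr 2
  push_cast
  ring

lemma aux_repr {n : ℕ} (A : Finset (Fin n → ℤ)) (c : (Fin n → ℤ) → ℂ) (x : Fin n → ℝ) (i : Fin n)
    (y : ℝ) (h : (y : ℂ) = -∑ a ∈ A, forceTerm c a x * (a i : ℂ)) :
    y = ∑ a ∈ A, (a i : ℝ) * auxR c a x := by
  have h2 := congrArg Complex.re h
  rw [Complex.ofReal_re] at h2
  rw [h2, ← Finset.sum_neg_distrib, Complex.re_sum]
  refine Finset.sum_congr rfl fun a _ => ?_
  rw [aux_force, auxR, ← neg_mul]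
  have : ((a i : ℤ) : ℂ) = ((a i : ℝ) : ℂ) := by push_cast; rfl
  rw [this, Complex.re_mul_ofReal]
  ring

lemma auxE_norm {n : ℕ} (a : Fin n → ℤ) (x : Fin n → ℝ) : ‖auxE a x‖ = 1 := by
  unfold auxE
  rw [mul_comm]
  exact Complex.norm_exp_ofReal_mul_I _

lemma auxE_lip {n : ℕ} (a : Fin n → ℤ) (x y : Fin n → ℝ) :
    ‖auxE a x - auxE a y‖ ≤ 2 * Real.pi * auxN a * ‖x - y‖ := by
  have h : auxE a x - auxE a y = auxE a y *
      (Complex.exp (Complex.I * ((2 * Real.pi * auxDot a (x - y) : ℝ) : ℂ)) - 1) := by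
    rw [auxDot_sub]
    unfold auxE
    rw [mul_sub, ← Complex.exp_add, mul_one]
    congr 2
    push_cast
    ring
  rw [h, norm_mul, auxE_norm, one_mul]
  refine (Real.norm_exp_I_mul_ofReal_sub_one_le).trans ?_
  rw [Real.norm_eq_abs, abs_mul, abs_of_pos Real.two_pi_pos, mul_assoc _ (auxN a)]
  exact mul_le_mul_of_nonneg_left (auxDot_le _ _) Real.two_pi_pos.le

lemma auxS_le {n : ℕ} (c : (Fin n → ℤ) → ℂ) (a : Fin n → ℤ) (x : Fin n → ℝ) :
    |auxS c a x| ≤ ‖c a‖ := by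
  refine (Complex.abs_re_le_norm _).trans ?_
  rw [norm_neg, norm_mul, auxE_norm, mul_one]

lemma aux_const (z : ℂ) : ‖2 * (Real.pi : ℂ) * Complex.I * z‖ = 2 * Real.pi * ‖z‖ := by
  simp [abs_of_pos Real.pi_pos]

lemma auxR_le {n : ℕ} (c : (Fin n → ℤ) → ℂ) (a : Fin n → ℤ) (x : Fin n → ℝ) :
    |auxR c a x| ≤ 2 * Real.pi * ‖c a‖ := by
  refine (Complex.abs_re_le_norm _).trans ?_
  rw [norm_neg, norm_mul, auxE_norm, mul_one, aux_const]

lemma auxR_lip {n : ℕ} (c : (Fin n → ℤ) → ℂ) (a : Fin n → ℤ) (x y : Fin n → ℝ) :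
    |auxR c a x - auxR c a y| ≤ 2 * Real.pi * ‖c a‖ * (2 * Real.pi * auxN a) * ‖x - y‖ := by
  unfold auxR
  rw [← Complex.sub_re]
  refine (Complex.abs_re_le_norm _).trans ?_
  rw [← neg_sub', norm_neg, ← mul_sub, norm_mul, aux_const, mul_assoc _ (2 * Real.pi * auxN a)]
  exact mul_le_mul_of_nonneg_left (auxE_lip a x y) (by positivity)

lemma auxDot_deriv {n : ℕ} (a : Fin n → ℤ) (q : ℝ → Fin n → ℝ) (v : Fin n → ℝ) (s : Set ℝ) (t : ℝ)
    (h : HasDerivWithinAt q v s t) :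
    HasDerivWithinAt (fun t => auxDot a (q t)) (auxDot a v) s t := by
  unfold auxDot
  refine HasDerivWithinAt.fun_sum fun j _ => ?_
  exact ((hasDerivWithinAt_pi.1 h) j).const_mul _

lemma auxS_deriv {n : ℕ} (c : (Fin n → ℤ) → ℂ) (a : Fin n → ℤ) (q : ℝ → Fin n → ℝ)
    (v : Fin n → ℝ) (s : Set ℝ) (t : ℝ) (h : HasDerivWithinAt q v s t) :
    HasDerivWithinAt (fun t => auxS c a (q t)) (auxDot a v * auxR c a (q t)) s t := by
  have h1 := ((auxDot_deriv a q v s t h).const_mul (2 * Real.pi)).ofReal_comp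
  have h2 := ((h1.const_mul Complex.I).cexp.const_mul (c a)).neg
  have h3 := (Complex.reCLM.hasFDerivAt (x := -(c a * auxE a (q t)))).comp_hasDerivWithinAt t h2
  refine h3.congr_deriv ?_
  unfold auxR
  rw [Complex.reCLM_apply, ← Complex.re_ofReal_mul]
  congr 1
  unfold auxE
  push_cast
  ring

/-- Let `V` be a trigonometric potential on `Tⁿ` with frequency set `F` (with `F = −F`,
`c_{−a} = conj(c_a)`), let `b ∈ ℤⁿ` and let `V_b` be the part of `V` with frequencies in
`F ∩ {b,−b}`, so the force field of `V − V_b` is the sum over `F \ {b,−b}`.  For every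
`δ > 0` there is `D > 0` such that for every initial datum `(x₀,p₀)` with `|b·p₀| > D`
and all solutions of Hamilton's equations (on the cover, curves on `[0,1]`) for the force
fields `−∇V` and `−∇(V−V_b)` with this common initial datum, the endpoints at time `1`
are within distance `δ`. -/
theorem stmt11 (n : ℕ) (hn : 1 ≤ n)
    (F : Finset (Fin n → ℤ)) (c : (Fin n → ℤ) → ℂ)
    (hFsymm : ∀ a ∈ F, -a ∈ F) (hcsymm : ∀ a, c (-a) = starRingEnd ℂ (c a))
    (b : Fin n → ℤ)
    (G Gb : (Fin n → ℝ) → Fin n → ℝ)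
    (hG : ∀ (x : Fin n → ℝ) (i : Fin n),
      ((G x i : ℝ) : ℂ) = -∑ a ∈ F, forceTerm c a x * (a i : ℂ))
    (hGb : ∀ (x : Fin n → ℝ) (i : Fin n),
      ((Gb x i : ℝ) : ℂ) =
        -∑ a ∈ F.filter fun a => a ≠ b ∧ a ≠ -b, forceTerm c a x * (a i : ℂ))
    (δ : ℝ) (hδ : 0 < δ) :
    ∃ D : ℝ, 0 < D ∧ ∀ x₀ p₀ : Fin n → ℝ, D < |∑ i, (b i : ℝ) * p₀ i| →
      ∀ q p q' p' : ℝ → Fin n → ℝ,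
        ContinuousOn q (Set.Icc 0 1) → ContinuousOn p (Set.Icc 0 1) →
        ContinuousOn q' (Set.Icc 0 1) → ContinuousOn p' (Set.Icc 0 1) →
        (∀ t ∈ Set.Icc (0 : ℝ) 1, p t = p₀ + ∫ s in (0 : ℝ)..t, G (q s)) →
        (∀ t ∈ Set.Icc (0 : ℝ) 1, q t = x₀ + ∫ s in (0 : ℝ)..t, p s) →
        (∀ t ∈ Set.Icc (0 : ℝ) 1, p' t = p₀ + ∫ s in (0 : ℝ)..t, Gb (q' s)) →
        (∀ t ∈ Set.Icc (0 : ℝ) 1, q' t = x₀ + ∫ s in (0 : ℝ)..t, p' s) →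
        torusDist (q 1, p 1) (q' 1, p' 1) < δ := by
  set A : Finset (Fin n → ℤ) := F.filter fun a => ¬ (a ≠ b ∧ a ≠ -b) with hA
  set A' : Finset (Fin n → ℤ) := F.filter fun a => (a ≠ b ∧ a ≠ -b) with hA'
  have hG1 : ∀ x i, G x i = ∑ a ∈ F, (a i : ℝ) * auxR c a x :=
    fun x i => aux_repr F c x i _ (hG x i)
  have hGb1 : ∀ x i, Gb x i = ∑ a ∈ A', (a i : ℝ) * auxR c a x :=
    fun x i => aux_repr A' c x i _ (hGb x i)
  have hsplit : ∀ x i, G x i = Gb x i + ∑ a ∈ A, (a i : ℝ) * auxR c a x := by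
    intro x i
    rw [hG1, hGb1, hA, hA', Finset.sum_filter_add_sum_filter_not]
  set B : ℝ := ∑ a ∈ F, auxN a * (2 * Real.pi * ‖c a‖) with hB
  have hB0 : 0 ≤ B := Finset.sum_nonneg fun a _ =>
    mul_nonneg (auxN_nonneg a) (by positivity)
  have hGB : ∀ x, ‖G x‖ ≤ B := by
    intro x
    refine (pi_norm_le_iff_of_nonneg hB0).2 fun i => ?_
    rw [hG1, Real.norm_eq_abs]
    refine (Finset.abs_sum_le_sum_abs _ _).trans (Finset.sum_le_sum fun a _ => ?_)
    rw [abs_mul]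
    exact mul_le_mul (auxN_coord a i) (auxR_le c a x) (abs_nonneg _) (auxN_nonneg a)
  have hlip : ∀ (H : (Fin n → ℝ) → Fin n → ℝ) (S : Finset (Fin n → ℤ)),
      (∀ x i, H x i = ∑ a ∈ S, (a i : ℝ) * auxR c a x) →
      ∃ L : ℝ, 0 ≤ L ∧ ∀ x y, ‖H x - H y‖ ≤ L * ‖x - y‖ := by
    intro H S hH
    have hL0 : 0 ≤ ∑ a ∈ S, auxN a * (2 * Real.pi * ‖c a‖ * (2 * Real.pi * auxN a)) := by
      refine Finset.sum_nonneg fun a _ => ?_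
      have := auxN_nonneg a
      positivity
    refine ⟨∑ a ∈ S, auxN a * (2 * Real.pi * ‖c a‖ * (2 * Real.pi * auxN a)), hL0, fun x y => ?_⟩
    refine (pi_norm_le_iff_of_nonneg (mul_nonneg hL0 (norm_nonneg _))).2 fun i => ?_
    rw [Pi.sub_apply, hH, hH, ← Finset.sum_sub_distrib, Real.norm_eq_abs, Finset.sum_mul]
    refine (Finset.abs_sum_le_sum_abs _ _).trans (Finset.sum_le_sum fun a _ => ?_)
    rw [← mul_sub, abs_mul, mul_assoc]
    exact mul_le_mul (auxN_coord a i) (auxR_lip c a x y) (abs_nonneg _) (auxN_nonneg a)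
  obtain ⟨L, hL0, hL⟩ := hlip Gb A' hGb1
  obtain ⟨LG, hLG0, hLG⟩ := hlip G F hG1
  have hcont : ∀ (H : (Fin n → ℝ) → Fin n → ℝ) (K : ℝ), 0 ≤ K →
      (∀ x y, ‖H x - H y‖ ≤ K * ‖x - y‖) → Continuous H := by
    intro H K hK h
    refine (LipschitzWith.of_dist_le_mul (K := ⟨K, hK⟩) fun x y => ?_).continuous
    rw [dist_eq_norm, dist_eq_norm]
    exact h x y
  have hGc := hcont G LG hLG0 hLG
  have hGbc := hcont Gb L hL0 hL
  set C : ℝ := ∑ a ∈ A, auxN a * ‖c a‖ * (1 + auxN a * B) with hC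
  have hC0 : 0 ≤ C := Finset.sum_nonneg fun a _ => by
    have := auxN_nonneg a
    positivity
  set K : ℝ := L + 1 with hK
  have hK1 : 1 ≤ K := by linarith
  obtain ⟨η, hη0, hη⟩ : ∃ η : ℝ, 0 < η ∧ 2 * n * (3 * η * Real.exp K) ^ 2 < δ ^ 2 := by
    have hc : Continuous fun η : ℝ => 2 * n * (3 * η * Real.exp K) ^ 2 := by fun_prop
    have h0 : Filter.Tendsto (fun η : ℝ => 2 * n * (3 * η * Real.exp K) ^ 2)
        (nhdsWithin 0 (Set.Ioi 0)) (nhds 0) := by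
      have := hc.tendsto 0
      simp only [mul_zero, zero_mul, ne_eq, OfNat.ofNat_ne_zero, not_false_eq_true,
        zero_pow] at this
      exact this.mono_left nhdsWithin_le_nhds
    have h1 := h0.eventually (gt_mem_nhds (show (0:ℝ) < δ ^ 2 by positivity))
    obtain ⟨η, h2, h3⟩ := (h1.and self_mem_nhdsWithin).exists
    exact ⟨η, h3, h2⟩
  set m : ℝ := max 1 (C / η) with hm
  have hm1 : 1 ≤ m := le_max_left _ _
  have hmC : C / m ≤ η := by
    rw [div_le_iff₀ (by linarith), mul_comm, ← div_le_iff₀ hη0]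
    exact le_max_right _ _
  have hm0 : 0 < m := by linarith
  refine ⟨m + auxN b * B, by have := mul_nonneg (auxN_nonneg b) hB0; linarith, ?_⟩
  intro x₀ p₀ hD q p q' p' hq hp hq' hp' ep eq ep' eq'
  change m + auxN b * B < |auxDot b p₀| at hD
  have dp := aux_ftc p (fun s => G (q s)) p₀ (hGc.comp_continuousOn hq) ep
  have dq := aux_ftc q p x₀ hp eq
  have dp' := aux_ftc p' (fun s => Gb (q' s)) p₀ (hGbc.comp_continuousOn hq') ep'
  have dq' := aux_ftc q' p' x₀ hp' eq'
  have hlow : ∀ t ∈ Set.Icc (0:ℝ) 1, ∀ a ∈ A, m ≤ |auxDot a (p t)| := by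
    intro t ht a ha
    have h1 : ‖p t - p₀‖ ≤ B := by
      rw [ep t ht, add_sub_cancel_left]
      refine (intervalIntegral.norm_integral_le_of_norm_le_const (C := B)
        fun s _ => hGB _).trans ?_
      rw [sub_zero, abs_of_nonneg ht.1]
      exact mul_le_of_le_one_right hB0 ht.2
    have h2 : |auxDot b (p t) - auxDot b p₀| ≤ auxN b * B := by
      rw [← auxDot_sub]
      exact (auxDot_le _ _).trans (mul_le_mul_of_nonneg_left h1 (auxN_nonneg b))
    have h3 : m ≤ |auxDot b (p t)| := by
      have := abs_sub_abs_le_abs_sub (auxDot b p₀) (auxDot b (p t))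
      rw [abs_sub_comm] at this
      linarith
    have h4 : a = b ∨ a = -b := by
      have := (Finset.mem_filter.1 ha).2
      tauto
    rcases h4 with rfl | rfl
    · exact h3
    · rwa [auxDot_neg, abs_neg]
  set W : ℝ → Fin n → ℝ := fun t i =>
    ∑ a ∈ A, (a i : ℝ) * (auxS c a (q t) / auxDot a (p t)) with hW
  set Q : ℝ → Fin n → ℝ := fun t i =>
    ∑ a ∈ A, (a i : ℝ) * (auxS c a (q t) * auxDot a (G (q t)) / (auxDot a (p t)) ^ 2) with hQ
  have hWη : ∀ t ∈ Set.Icc (0:ℝ) 1, ‖W t‖ ≤ η := by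
    intro t ht
    refine (?_ : ‖W t‖ ≤ C / m).trans hmC
    refine (pi_norm_le_iff_of_nonneg (by positivity)).2 fun i => ?_
    rw [Real.norm_eq_abs, hC, Finset.sum_div]
    refine (Finset.abs_sum_le_sum_abs _ _).trans (Finset.sum_le_sum fun a ha => ?_)
    have hN := auxN_nonneg a
    calc |(a i : ℝ) * (auxS c a (q t) / auxDot a (p t))|
        = |(a i : ℝ)| * (|auxS c a (q t)| / |auxDot a (p t)|) := by rw [abs_mul, abs_div]
      _ ≤ auxN a * (‖c a‖ / m) := by
          gcongr
          · exact auxN_coord a i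
          · exact auxS_le c a _
          · exact hlow t ht a ha
      _ = auxN a * ‖c a‖ * 1 / m := by ring
      _ ≤ _ := by
          gcongr
          have := mul_nonneg hN hB0
          linarith
  have hQη : ∀ t ∈ Set.Icc (0:ℝ) 1, ‖Q t‖ ≤ η := by
    intro t ht
    refine (?_ : ‖Q t‖ ≤ C / m).trans hmC
    refine (pi_norm_le_iff_of_nonneg (by positivity)).2 fun i => ?_
    rw [Real.norm_eq_abs, hC, Finset.sum_div]
    refine (Finset.abs_sum_le_sum_abs _ _).trans (Finset.sum_le_sum fun a ha => ?_)
    have hN := auxN_nonneg a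
    have hl := hlow t ht a ha
    calc |(a i : ℝ) * (auxS c a (q t) * auxDot a (G (q t)) / (auxDot a (p t)) ^ 2)|
        = |(a i : ℝ)| * (|auxS c a (q t)| * |auxDot a (G (q t))| / |auxDot a (p t)| ^ 2) := by
          rw [abs_mul, abs_div, abs_mul, abs_pow]
      _ ≤ auxN a * (‖c a‖ * (auxN a * B) / m) := by
          gcongr
          · exact auxN_coord a i
          · exact auxS_le c a _
          · exact (auxDot_le _ _).trans (mul_le_mul_of_nonneg_left (hGB _) hN)
          · nlinarith
      _ = auxN a * ‖c a‖ * (auxN a * B) / m := by ring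
      _ ≤ _ := by
          gcongr
          linarith
  have hWd : ∀ t ∈ Set.Ico (0:ℝ) 1,
      HasDerivWithinAt W (G (q t) - Gb (q t) - Q t) (Set.Ici t) t := by
    intro t ht
    refine hasDerivWithinAt_pi.2 fun i => ?_
    have h1 : HasDerivWithinAt (fun t => W t i) (∑ a ∈ A, (a i : ℝ) *
        ((auxDot a (p t) * auxR c a (q t) * auxDot a (p t) -
          auxS c a (q t) * auxDot a (G (q t))) / auxDot a (p t) ^ 2)) (Set.Ici t) t := by
      refine HasDerivWithinAt.fun_sum fun a ha => ?_
      have hl := hlow t ⟨ht.1, ht.2.le⟩ a ha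
      have hne : auxDot a (p t) ≠ 0 := by
        intro h0
        rw [h0, abs_zero] at hl
        linarith
      exact ((auxS_deriv c a q _ _ t (dq t ht)).fun_div
        (auxDot_deriv a p _ _ t (dp t ht)) hne).const_mul _
    refine h1.congr_deriv ?_
    rw [Pi.sub_apply, Pi.sub_apply, hsplit, add_sub_cancel_left, hQ, ← Finset.sum_sub_distrib]
    refine Finset.sum_congr rfl fun a ha => ?_
    have hl := hlow t ⟨ht.1, ht.2.le⟩ a ha
    have hne : auxDot a (p t) ≠ 0 := by
      intro h0
      rw [h0, abs_zero] at hl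
      linarith
    field_simp
  have hSc : ∀ a, Continuous (auxS c a) := by
    intro a
    unfold auxS auxE auxDot
    fun_prop
  have hDc : ∀ a : Fin n → ℤ, Continuous (auxDot a) := by
    intro a
    unfold auxDot
    fun_prop
  have hWc : ContinuousOn W (Set.Icc 0 1) := by
    refine continuousOn_pi.2 fun i => ?_
    refine continuousOn_finsetSum _ fun a ha => ?_
    refine continuousOn_const.mul (((hSc a).comp_continuousOn hq).div
      ((hDc a).comp_continuousOn hp) fun t ht h0 => ?_)
    have hl := hlow t ht a ha
    have h0' : auxDot a (p t) = 0 := h0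
    rw [h0', abs_zero] at hl
    linarith
  have hz := norm_le_gronwallBound_of_norm_deriv_right_le (a := 0) (b := 1) (δ := η) (K := K)
    (ε := η)
    (f := fun t => ((q t - q' t, p t - p' t - W t) : (Fin n → ℝ) × (Fin n → ℝ)))
    (f' := fun t => (p t - p' t, G (q t) - Gb (q' t) - (G (q t) - Gb (q t) - Q t)))
    ((hq.sub hq').prodMk ((hp.sub hp').sub hWc))
    (fun t ht => ((dq t ht).sub (dq' t ht)).prodMk (((dp t ht).sub (dp' t ht)).sub (hWd t ht)))
    (by
      have h0 : (0:ℝ) ∈ Set.Icc (0:ℝ) 1 := by simp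
      have e1 := eq 0 h0
      have e2 := eq' 0 h0
      have e3 := ep 0 h0
      have e4 := ep' 0 h0
      rw [intervalIntegral.integral_same, add_zero] at e1 e2 e3 e4
      rw [e1, e2, e3, e4, sub_self, sub_self, zero_sub]
      refine norm_prod_le_iff.2 ⟨?_, ?_⟩
      · simpa using hη0.le
      · simpa using hWη 0 h0)
    (by
      intro t ht
      have ht' : t ∈ Set.Icc (0:ℝ) 1 := ⟨ht.1, ht.2.le⟩
      set z : (Fin n → ℝ) × (Fin n → ℝ) := (q t - q' t, p t - p' t - W t) with hz
      have hz1 : ‖q t - q' t‖ ≤ ‖z‖ := norm_fst_le z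
      have hz2 : ‖p t - p' t - W t‖ ≤ ‖z‖ := norm_snd_le z
      have hz0 : 0 ≤ ‖z‖ := norm_nonneg z
      have hLz := mul_nonneg hL0 hz0
      refine norm_prod_le_iff.2 ⟨?_, ?_⟩
      · have h1 : ‖p t - p' t‖ ≤ ‖p t - p' t - W t‖ + ‖W t‖ := by
          simpa using norm_add_le (p t - p' t - W t) (W t)
        have h2 := hWη t ht'
        change ‖p t - p' t‖ ≤ (L + 1) * ‖z‖ + η
        linarith
      · have h1 : G (q t) - Gb (q' t) - (G (q t) - Gb (q t) - Q t)
            = (Gb (q t) - Gb (q' t)) + Q t := by abel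
        change ‖G (q t) - Gb (q' t) - (G (q t) - Gb (q t) - Q t)‖ ≤ (L + 1) * ‖z‖ + η
        rw [h1]
        have h2 := norm_add_le (Gb (q t) - Gb (q' t)) (Q t)
        have h3 := hL (q t) (q' t)
        have h4 := hQη t ht'
        have h5 := mul_le_mul_of_nonneg_left hz1 hL0
        linarith) 1 (by simp)
  have hexp : 1 ≤ Real.exp K := Real.one_le_exp (by linarith)
  have hgb : gronwallBound η K η (1 - 0) ≤ 2 * η * Real.exp K := by
    rw [gronwallBound_of_K_ne_0 (by linarith), sub_zero]
    beta_reduce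
    rw [mul_one]
    have h1 : η / K ≤ η := div_le_self hη0.le hK1
    have h2 : η / K * (Real.exp K - 1) ≤ η * (Real.exp K - 1) :=
      mul_le_mul_of_nonneg_right h1 (by linarith)
    linarith
  have hz := hz.trans hgb
  obtain ⟨hza, hzb⟩ := norm_prod_le_iff.1 hz
  have hηe : η ≤ η * Real.exp K := le_mul_of_one_le_right hη0.le hexp
  have hw : ‖q 1 - q' 1‖ ≤ 3 * η * Real.exp K := by
    change ‖q 1 - q' 1‖ ≤ _ at hza
    linarith
  have hu : ‖p 1 - p' 1‖ ≤ 3 * η * Real.exp K := by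
    change ‖p 1 - p' 1 - W 1‖ ≤ _ at hzb
    have h1 : ‖p 1 - p' 1‖ ≤ ‖p 1 - p' 1 - W 1‖ + ‖W 1‖ := by
      simpa using norm_add_le (p 1 - p' 1 - W 1) (W 1)
    have h2 := hWη 1 (by simp)
    linarith
  have hsq : ∀ v : Fin n → ℝ, ‖v‖ ≤ 3 * η * Real.exp K →
      ∑ i, (v i) ^ 2 ≤ n * (3 * η * Real.exp K) ^ 2 := by
    intro v hv
    have : ∑ i : Fin n, (v i) ^ 2 ≤ ∑ i : Fin n, (3 * η * Real.exp K) ^ 2 := by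
      refine Finset.sum_le_sum fun i _ => ?_
      rw [← sq_abs]
      exact pow_le_pow_left₀ (abs_nonneg _) ((norm_le_pi_norm v i).trans hv) 2
    simpa using this
  have hw2 := hsq _ hw
  have hu2 := hsq _ hu
  unfold torusDist
  refine (ciInf_le ⟨0, ?_⟩ (0 : Fin n → ℤ)).trans_lt ?_
  · rintro _ ⟨m, rfl⟩
    exact Real.sqrt_nonneg _
  · rw [Real.sqrt_lt' hδ]
    simp only [Pi.zero_apply, Int.cast_zero, sub_zero]
    simp only [Pi.sub_apply] at hw2 hu2
    linarith

end
end
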